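/- The linear Nakayama algebra A_{4,(1)}^{(3)} (the quotient of the path algebra of the linearly oriented quiver 1 → 2 → 3 → 4 by the path of length 3 from vertex 1 to vertex 4) is derived equivalent to the path algebra of any orientation of the Dynkin tree D_4. -/

import Mathlib

open CategoryTheory

/-- A finite quiver: a finite vertex type, an arrow type, and source/target maps. -/
structure PreQuiver where
  V : Type
  A : Type
  [fintV : Fintype V]
  s : A → V
  t : A → V

attribute [instance] PreQuiver.fintV

/-- The defining relations presenting the path algebra of the quiver `Q` over `k`, together
with the zero relations given by the paths (lists of composable arrows) in `R`.  The
generators are the trivial paths `Sum.inl v` (one for each vertex) and the arrows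
`Sum.inr a`; multiplication of generators corresponds to concatenation of paths, so that the
resulting algebra has as a basis the paths of `Q` (not passing through a relation of `R`). -/
inductive PathAlgRel (k : Type) [Field k] (Q : PreQuiver) (R : Set (List Q.A)) :
    FreeAlgebra k (Q.V ⊕ Q.A) → FreeAlgebra k (Q.V ⊕ Q.A) → Prop
  | idem (v : Q.V) :
      PathAlgRel k Q R (FreeAlgebra.ι k (Sum.inl v) * FreeAlgebra.ι k (Sum.inl v))
        (FreeAlgebra.ι k (Sum.inl v))
  | orth (v w : Q.V) (h : v ≠ w) :
      PathAlgRel k Q R (FreeAlgebra.ι k (Sum.inl v) * FreeAlgebra.ι k (Sum.inl w)) 0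
  | unit :
      PathAlgRel k Q R (∑ v : Q.V, FreeAlgebra.ι k (Sum.inl v)) 1
  | source (a : Q.A) :
      PathAlgRel k Q R (FreeAlgebra.ι k (Sum.inl (Q.s a)) * FreeAlgebra.ι k (Sum.inr a))
        (FreeAlgebra.ι k (Sum.inr a))
  | target (a : Q.A) :
      PathAlgRel k Q R (FreeAlgebra.ι k (Sum.inr a) * FreeAlgebra.ι k (Sum.inl (Q.t a)))
        (FreeAlgebra.ι k (Sum.inr a))
  | zeroRel (p : List Q.A) (hp : p ∈ R) :
      PathAlgRel k Q R ((p.map fun a => FreeAlgebra.ι k (Sum.inr a)).prod) 0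

/-- The path algebra of the quiver `Q` over the field `k`, modulo the two-sided ideal
generated by the zero relations in `R`. -/
abbrev PathAlgebraRel (k : Type) [Field k] (Q : PreQuiver) (R : Set (List Q.A)) : Type :=
  RingQuot (PathAlgRel k Q R)

/-- The path algebra of the quiver `Q` over the field `k`. -/
abbrev PathAlgebra (k : Type) [Field k] (Q : PreQuiver) : Type :=
  PathAlgebraRel k Q ∅

noncomputable instance (C : Type*) [Category C] [Abelian C] : HasDerivedCategory C :=
  HasDerivedCategory.standard C

/-- Two `k`-algebras are *derived equivalent* if there is a triangulated equivalence between
the derived categories of their categories of right modules (i.e. of left modules over the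
opposite rings). -/
def DerivedEquivalent (k : Type) [Field k] (A : Type) [Ring A] [Algebra k A]
    (B : Type) [Ring B] [Algebra k B] : Prop :=
  ∃ (F : DerivedCategory (ModuleCat.{0} Aᵐᵒᵖ) ⥤ DerivedCategory (ModuleCat.{0} Bᵐᵒᵖ))
    (c : F.CommShift ℤ), haveI := c; (F.IsTriangulated ∧ F.IsEquivalence)

/-- The linearly ordered quiver `A_n` of Dynkin type `A`, with vertices `1, …, n`
(realized as `Fin n`) and an arrow from each vertex to the next one. -/
def linQuiver (n : ℕ) : PreQuiver where
  V := Fin n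
  A := Fin (n - 1)
  s := fun a => ⟨a.1, by have := a.2; omega⟩
  t := fun a => ⟨a.1 + 1, by have := a.2; omega⟩

/-- The path of length `l` in the quiver `A_n` starting at the (1-indexed) vertex `v`. -/
def linPath (n : ℕ) (v l : ℕ) : List (linQuiver n).A :=
  (List.range l).filterMap fun j =>
    if h : v - 1 + j < n - 1 then some ⟨v - 1 + j, h⟩ else none

/-- The linear Nakayama algebra `A_{n,(n_0,…,n_{t-1})}^{(l_0,…,l_{t-1})}`: the quotient of
the path algebra of `A_n` over `k` by the two-sided ideal generated, for each `i`, by the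
path of length `ls i` starting at the vertex `ns i`. -/
abbrev NakayamaAlgebra (k : Type) [Field k] (n t : ℕ) (ns ls : Fin t → ℕ) : Type :=
  PathAlgebraRel k (linQuiver n) {p | ∃ i : Fin t, p = linPath n (ns i) (ls i)}

/-- The hypotheses on the data of a linear Nakayama algebra
`A_{n,(n_0,…,n_{t-1})}^{(l_0,…,l_{t-1})}` with almost separate relations: each relation
starts at a vertex `ns i ≥ 1` and has length `ls i ≥ 2`, the start vertices are strictly
increasing, the end vertices `ns i + ls i` are strictly increasing and at most `n`, and the
overlap of two relations is at most one arrow (`ns j ≥ ns i + ls i - 1` for `i < j`). -/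
structure IsASNakayama (n t : ℕ) (ns ls : Fin t → ℕ) : Prop where
  one_le : ∀ i, 1 ≤ ns i
  two_le : ∀ i, 2 ≤ ls i
  start_lt : ∀ i j, i < j → ns i < ns j
  end_lt : ∀ i j, i < j → ns i + ls i < ns j + ls j
  end_le : ∀ i, ns i + ls i ≤ n
  almost_separate : ∀ i j, i < j → ns i + ls i ≤ ns j + 1

/-- An orientation of a graph, given by a relation selecting a direction for each edge,
regarded as a quiver. -/
def orientQuiver (V : Type) [Fintype V] (o : V → V → Prop) : PreQuiver where
  V := V
  A := { p : V × V // o p.1 p.2 }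
  s := fun a => a.1.1
  t := fun a => a.1.2

/-- `o` is an orientation of the simple graph `G` if each edge of `G` is directed in exactly
one way by `o`, and `o` directs nothing else. -/
def IsOrientation {V : Type} (G : SimpleGraph V) (o : V → V → Prop) : Prop :=
  (∀ v w, G.Adj v w ↔ o v w ∨ o w v) ∧ ∀ v w, o v w → ¬o w v

/-- The Dynkin tree `D_4`: a star with central vertex `0` joined to the three leaves
`1`, `2`, `3`. -/
def dynkinD4 : SimpleGraph (Fin 4) :=
  SimpleGraph.fromRel fun x _ => x.1 = 0

section FormalPart

open CategoryTheory Limits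

/-- A triangulated equivalence between derived categories, obtained from two presentations
of these categories as localizations of the same category of complexes. -/
theorem formal_equivalence {E L R : Type 1} [Category.{0} E] [Category.{0} L] [Category.{0} R]
    [Preadditive E] [HasZeroObject E] [HasBinaryBiproducts E] [Abelian L] [Abelian R]
    (a : E ⥤ L) (b : E ⥤ R) [a.Additive] [b.Additive]
    (W : MorphismProperty (CochainComplex E ℤ))
    (ha : (a.mapHomologicalComplex (ComplexShape.up ℤ) ⋙ DerivedCategory.Q).IsLocalization W)
    (hb : (b.mapHomologicalComplex (ComplexShape.up ℤ) ⋙ DerivedCategory.Q).IsLocalization W)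
    (hW : HomologicalComplex.homotopyEquivalences E (ComplexShape.up ℤ) ≤ W)
    (hess : (a.mapHomologicalComplex (ComplexShape.up ℤ) ⋙ DerivedCategory.Q).mapArrow.EssSurj) :
    ∃ (F : DerivedCategory L ⥤ DerivedCategory R) (c : F.CommShift ℤ),
      haveI := c; (F.IsTriangulated ∧ F.IsEquivalence) := by
  let La := a.mapHomotopyCategory (ComplexShape.up ℤ) ⋙ DerivedCategory.Qh
  let Lb := b.mapHomotopyCategory (ComplexShape.up ℤ) ⋙ DerivedCategory.Qh
  let q := HomotopyCategory.quotient E (ComplexShape.up ℤ)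
  let ea : q ⋙ La ≅ a.mapHomologicalComplex (ComplexShape.up ℤ) ⋙ DerivedCategory.Q :=
    (Functor.associator _ _ _).symm ≪≫
      Functor.isoWhiskerRight (a.mapHomotopyCategoryFactors (ComplexShape.up ℤ)) _ ≪≫
      Functor.associator _ _ _ ≪≫
      Functor.isoWhiskerLeft _ (DerivedCategory.quotientCompQhIso L)
  let eb : q ⋙ Lb ≅ b.mapHomologicalComplex (ComplexShape.up ℤ) ⋙ DerivedCategory.Q :=
    (Functor.associator _ _ _).symm ≪≫
      Functor.isoWhiskerRight (b.mapHomotopyCategoryFactors (ComplexShape.up ℤ)) _ ≪≫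
      Functor.associator _ _ _ ≪≫
      Functor.isoWhiskerLeft _ (DerivedCategory.quotientCompQhIso R)
  have ha' : (q ⋙ La).IsLocalization W := Functor.IsLocalization.of_iso W ea.symm
  have hb' : (q ⋙ Lb).IsLocalization W := Functor.IsLocalization.of_iso W eb.symm
  have hLa : La.IsLocalization (W.map q) :=
    Functor.IsLocalization.of_comp q La _ _ W hW rfl
  have hLb : Lb.IsLocalization (W.map q) :=
    Functor.IsLocalization.of_comp q Lb _ _ W hW rfl
  have hess' : La.mapArrow.EssSurj := by
    constructor
    intro g
    obtain ⟨f, ⟨e⟩⟩ := hess.mem_essImage g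
    refine ⟨Arrow.mk (q.map f.hom), ⟨?_ ≪≫ e⟩⟩
    exact Arrow.isoMk (ea.app _) (ea.app _) (ea.hom.naturality f.hom).symm
  let F : DerivedCategory L ⥤ DerivedCategory R := (Localization.uniq La Lb (W.map q)).functor
  let : Localization.Lifting La (W.map q) Lb F :=
    ⟨Localization.compUniqFunctor La Lb (W.map q)⟩
  let c : F.CommShift ℤ := Functor.commShiftOfLocalization La (W.map q) ℤ Lb F
  have : NatTrans.CommShift (Localization.Lifting.iso La (W.map q) Lb F).hom ℤ := inferInstance
  refine ⟨F, c, ?_, ?_⟩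
  · exact Functor.isTriangulated_of_precomp_iso (Localization.Lifting.iso La (W.map q) Lb F)
  · dsimp only [F]; infer_instance

end FormalPart

section ResolutionPart

open CategoryTheory Limits

universe u₁ u₂ u₃ v₁ v₂ v₃

lemma loc_right {C₁ : Type u₁} {C₂ : Type u₂} {D : Type u₃} [Category.{v₁} C₁]
    [Category.{v₂} C₂] [Category.{v₃} D] (G : C₁ ⥤ C₂) [G.Full] [G.Faithful]
    (W₂ : MorphismProperty C₂) [W₂.HasTwoOutOfThreeProperty] [W₂.RespectsIso]
    (L : C₂ ⥤ D) [L.IsLocalization W₂] (Res : C₂ ⥤ C₂)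
    (hR : ∀ Y, G.essImage (Res.obj Y)) (α : 𝟭 C₂ ⟶ Res) (hα : ∀ Y, W₂ (α.app Y)) :
    (G ⋙ L).IsLocalization (W₂.inverseImage G) := by
  let Φ : LocalizerMorphism (W₂.inverseImage G) W₂ := LocalizerMorphism.ofEq (F := G) rfl
  have : Φ.functor.Full := inferInstanceAs G.Full
  have : Φ.functor.Faithful := inferInstanceAs G.Faithful
  let ρ := Functor.essImage.liftFunctor Res G hR
  let i : 𝟭 C₂ ⟶ ρ ⋙ Φ.functor := α ≫ (Functor.essImage.liftFunctorCompIso Res G hR).inv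
  have hi : ∀ Y, W₂ (i.app Y) := fun Y => by
    have h : i.app Y = α.app Y ≫ (Functor.essImage.liftFunctorCompIso Res G hR).inv.app Y := rfl
    rw [h]
    exact (MorphismProperty.cancel_right_of_respectsIso W₂ (α.app Y)
      ((Functor.essImage.liftFunctorCompIso Res G hR).symm.app Y).hom).2 (hα Y)
  have := Φ.isLocalizedEquivalence_of_functorial_right_resolutions i hi rfl
  exact LocalizerMorphism.IsLocalizedEquivalence.isLocalization Φ L

lemma loc_left {C₁ : Type u₁} {C₂ : Type u₂} {D : Type u₃} [Category.{v₁} C₁]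
    [Category.{v₂} C₂] [Category.{v₃} D] (G : C₁ ⥤ C₂) [G.Full] [G.Faithful]
    (W₂ : MorphismProperty C₂) [W₂.HasTwoOutOfThreeProperty] [W₂.RespectsIso]
    (L : C₂ ⥤ D) [L.IsLocalization W₂] (Res : C₂ ⥤ C₂)
    (hR : ∀ Y, G.essImage (Res.obj Y)) (β : Res ⟶ 𝟭 C₂) (hβ : ∀ Y, W₂ (β.app Y)) :
    (G ⋙ L).IsLocalization (W₂.inverseImage G) := by
  have : W₂.op.HasTwoOutOfThreeProperty :=
    { comp_mem := fun f g hf hg => W₂.comp_mem _ _ hg hf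
      of_postcomp := fun f g hg hfg => W₂.of_precomp g.unop f.unop hg hfg
      of_precomp := fun f g hf hfg => W₂.of_postcomp g.unop f.unop hf hfg }
  have := loc_right G.op W₂.op L.op Res.op
    (fun Y => by
      obtain ⟨X, ⟨e⟩⟩ := hR Y.unop
      exact ⟨Opposite.op X, ⟨e.symm.op⟩⟩)
    ({ app := fun Y => (β.app Y.unop).op
       naturality := fun X Y f => Quiver.Hom.unop_inj (β.naturality f.unop).symm })
    (fun Y => hβ Y.unop)
  exact (Functor.IsLocalization.op_iff (G ⋙ L) (W₂.inverseImage G)).1 this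

lemma arrow_right {C₁ : Type u₁} {C₂ : Type u₂} {D : Type u₃} [Category.{v₁} C₁]
    [Category.{v₂} C₂] [Category.{v₃} D] (G : C₁ ⥤ C₂) [G.Full]
    (W₂ : MorphismProperty C₂) 
    (L : C₂ ⥤ D) (hL : W₂.IsInvertedBy L) [L.mapArrow.EssSurj] (Res : C₂ ⥤ C₂)
    (hR : ∀ Y, G.essImage (Res.obj Y)) (α : 𝟭 C₂ ⟶ Res) (hα : ∀ Y, W₂ (α.app Y)) :
    (G ⋙ L).mapArrow.EssSurj := by
  constructor
  intro g
  obtain ⟨f, ⟨e⟩⟩ := Functor.EssSurj.mem_essImage (F := L.mapArrow) g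
  obtain ⟨X, ⟨eX⟩⟩ := hR f.left
  obtain ⟨Y, ⟨eY⟩⟩ := hR f.right
  have h₁ : IsIso (L.map (α.app f.left)) := hL _ (hα _)
  have h₂ : IsIso (L.map (α.app f.right)) := hL _ (hα _)
  refine ⟨Arrow.mk (G.preimage (eX.hom ≫ Res.map f.hom ≫ eY.inv)), ⟨Iso.trans ?_ e⟩⟩
  refine Arrow.isoMk (L.mapIso eX ≪≫ (asIso (L.map (α.app f.left))).symm)
    (L.mapIso eY ≪≫ (asIso (L.map (α.app f.right))).symm) ?_
  have := α.naturality f.hom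
  simp only [Functor.id_obj, Functor.id_map] at this
  have h2 := congrArg L.map this
  rw [L.map_comp, L.map_comp] at h2
  change (L.map eX.hom ≫ inv (L.map (α.app f.left))) ≫ L.map f.hom =
    L.map (G.map (G.preimage (eX.hom ≫ Res.map f.hom ≫ eY.inv))) ≫ L.map eY.hom ≫
      inv (L.map (α.app f.right))
  rw [G.map_preimage, ← cancel_mono (L.map (α.app f.right))]
  have h3 : inv (L.map (α.app f.left)) ≫ L.map f.hom ≫ L.map (α.app f.right) =
      L.map (Res.map f.hom) := by
    rw [h2]; exact IsIso.inv_hom_id_assoc (L.map (α.app f.left)) _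
  have h4 : L.map eY.inv ≫ L.map eY.hom = 𝟙 _ := by rw [← L.map_comp]; simp
  have h5 : inv (L.map (α.app f.right)) ≫ L.map (α.app f.right) = 𝟙 _ := IsIso.inv_hom_id _
  simp only [Category.assoc, L.map_comp]
  rw [h3, h5, reassoc_of% h4]
  simp

lemma arrow_left {C₁ : Type u₁} {C₂ : Type u₂} {D : Type u₃} [Category.{v₁} C₁]
    [Category.{v₂} C₂] [Category.{v₃} D] (G : C₁ ⥤ C₂) [G.Full]
    (W₂ : MorphismProperty C₂) 
    (L : C₂ ⥤ D) (hL : W₂.IsInvertedBy L) [L.mapArrow.EssSurj] (Res : C₂ ⥤ C₂)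
    (hR : ∀ Y, G.essImage (Res.obj Y)) (β : Res ⟶ 𝟭 C₂) (hβ : ∀ Y, W₂ (β.app Y)) :
    (G ⋙ L).mapArrow.EssSurj := by
  constructor
  intro g
  obtain ⟨f, ⟨e⟩⟩ := Functor.EssSurj.mem_essImage (F := L.mapArrow) g
  obtain ⟨X, ⟨eX⟩⟩ := hR f.left
  obtain ⟨Y, ⟨eY⟩⟩ := hR f.right
  have h₁ : IsIso (L.map (β.app f.left)) := hL _ (hβ _)
  have h₂ : IsIso (L.map (β.app f.right)) := hL _ (hβ _)
  refine ⟨Arrow.mk (G.preimage (eX.hom ≫ Res.map f.hom ≫ eY.inv)), ⟨Iso.trans ?_ e⟩⟩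
  refine Arrow.isoMk (L.mapIso eX ≪≫ (@asIso _ _ _ _ (L.map (β.app f.left)) h₁))
    (L.mapIso eY ≪≫ (@asIso _ _ _ _ (L.map (β.app f.right)) h₂)) ?_
  have := β.naturality f.hom
  simp only [Functor.id_obj, Functor.id_map] at this
  have h2 := congrArg L.map this
  rw [L.map_comp, L.map_comp] at h2
  change (L.map eX.hom ≫ (L.map (β.app f.left))) ≫ L.map f.hom =
    L.map (G.map (G.preimage (eX.hom ≫ Res.map f.hom ≫ eY.inv))) ≫ L.map eY.hom ≫
      (L.map (β.app f.right))
  rw [G.map_preimage]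
  have h4 : L.map eY.inv ≫ L.map eY.hom = 𝟙 _ := by rw [← L.map_comp]; simp
  simp only [Category.assoc, L.map_comp]
  rw [reassoc_of% h4, h2]

instance Q_mapArrow_essSurj {A : Type u₁} [Category.{v₁} A] [Abelian A] :
    (DerivedCategory.Q (C := A)).mapArrow.EssSurj := by
  constructor
  intro g
  obtain ⟨f, ⟨e⟩⟩ := Functor.EssSurj.mem_essImage (F := (DerivedCategory.Qh (C := A)).mapArrow) g
  obtain ⟨f', ⟨e'⟩⟩ := Functor.EssSurj.mem_essImage
    (F := (HomotopyCategory.quotient A (ComplexShape.up ℤ)).mapArrow) f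
  refine ⟨f', ⟨Iso.trans ?_ ((DerivedCategory.Qh (C := A)).mapArrow.mapIso e' ≪≫ e)⟩⟩
  exact Arrow.isoMk ((DerivedCategory.quotientCompQhIso A).symm.app _)
    ((DerivedCategory.quotientCompQhIso A).symm.app _)
    ((DerivedCategory.quotientCompQhIso A).symm.hom.naturality f'.hom).symm

/-- A complex whose terms are in the essential image is in the essential image. -/
lemma complex_essImage {E : Type u₁} {C : Type u₂} [Category.{v₁} E] [Category.{v₂} C]
    [Preadditive E] [Preadditive C] (r : E ⥤ C) [r.Additive] [r.Full] [r.Faithful]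
    (Y : CochainComplex C ℤ) (hY : ∀ n, r.essImage (Y.X n)) :
    (r.mapHomologicalComplex (ComplexShape.up ℤ)).essImage Y := by
  choose Z e using hY
  let e' : ∀ n, r.obj (Z n) ≅ Y.X n := fun n => (e n).some
  let K : CochainComplex E ℤ :=
    { X := Z
      d := fun i j => r.preimage ((e' i).hom ≫ Y.d i j ≫ (e' j).inv)
      shape := fun i j h => r.map_injective (by simp [Y.shape i j h])
      d_comp_d' := fun i j l _ _ => r.map_injective (by simp) }
  refine ⟨K, ⟨HomologicalComplex.Hom.isoOfComponents e' ?_⟩⟩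
  intro i j _
  change (e' i).hom ≫ Y.d i j = r.map (r.preimage ((e' i).hom ≫ Y.d i j ≫ (e' j).inv)) ≫ (e' j).hom
  rw [r.map_preimage, Category.assoc, Category.assoc, Iso.inv_hom_id, Category.comp_id]

/-- The combination of a full subcategory and an equivalence. -/
lemma loc_combined {E C A : Type 1} [Category.{0} E] [Category.{0} C] [Category.{0} A]
    [Preadditive E] [Preadditive C] [Abelian A] (r : E ⥤ C) (t : C ⥤ A)
    [r.Additive] [t.Additive] [r.Full] [r.Faithful] [t.IsEquivalence]
    (Res : CochainComplex C ℤ ⥤ CochainComplex C ℤ)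
    (hR : ∀ Y n, r.essImage ((Res.obj Y).X n))
    (h : (∃ α : 𝟭 _ ⟶ Res, ∀ Y, HomologicalComplex.quasiIso A (ComplexShape.up ℤ)
        ((t.mapHomologicalComplex (ComplexShape.up ℤ)).map (α.app Y))) ∨
      (∃ β : Res ⟶ 𝟭 _, ∀ Y, HomologicalComplex.quasiIso A (ComplexShape.up ℤ)
        ((t.mapHomologicalComplex (ComplexShape.up ℤ)).map (β.app Y)))) :
    ((r ⋙ t).mapHomologicalComplex (ComplexShape.up ℤ) ⋙ DerivedCategory.Q).IsLocalization
      ((HomologicalComplex.quasiIso A (ComplexShape.up ℤ)).inverseImage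
        ((r ⋙ t).mapHomologicalComplex (ComplexShape.up ℤ))) ∧
    ((r ⋙ t).mapHomologicalComplex (ComplexShape.up ℤ) ⋙
      DerivedCategory.Q).mapArrow.EssSurj := by
  let T := t.mapHomologicalComplex (ComplexShape.up ℤ)
  let G := r.mapHomologicalComplex (ComplexShape.up ℤ)
  have hT : T.IsEquivalence :=
    (t.asEquivalence.mapHomologicalComplex (ComplexShape.up ℤ)).isEquivalence_functor
  let W₂ := (HomologicalComplex.quasiIso A (ComplexShape.up ℤ)).inverseImage T
  have : W₂.RespectsIso := inferInstance
  have : W₂.HasTwoOutOfThreeProperty := inferInstance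
  let Φ : LocalizerMorphism W₂ (HomologicalComplex.quasiIso A (ComplexShape.up ℤ)) :=
    LocalizerMorphism.ofEq (F := T) rfl
  have : Φ.functor.IsEquivalence := hT
  have : Φ.IsInduced := ⟨rfl⟩
  have := Φ.isLocalizedEquivalence_of_isInduced
  have : (T ⋙ DerivedCategory.Q).IsLocalization W₂ :=
    LocalizerMorphism.IsLocalizedEquivalence.isLocalization Φ DerivedCategory.Q
  have : (T ⋙ DerivedCategory.Q).mapArrow.EssSurj := by
    constructor
    intro g
    obtain ⟨f, ⟨e⟩⟩ := Functor.EssSurj.mem_essImage (F := (DerivedCategory.Q (C := A)).mapArrow) g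
    obtain ⟨f', ⟨e'⟩⟩ := Functor.EssSurj.mem_essImage (F := T.mapArrow) f
    exact ⟨f', ⟨DerivedCategory.Q.mapArrow.mapIso e' ≪≫ e⟩⟩
  have hR' : ∀ Y, G.essImage (Res.obj Y) := fun Y => complex_essImage r _ (hR Y)
  have key : (G ⋙ T ⋙ DerivedCategory.Q).IsLocalization (W₂.inverseImage G) ∧
      (G ⋙ T ⋙ DerivedCategory.Q).mapArrow.EssSurj := by
    rcases h with ⟨α, hα⟩ | ⟨β, hβ⟩
    · exact ⟨loc_right G W₂ (T ⋙ DerivedCategory.Q) Res hR' α hα,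
        arrow_right G W₂ (T ⋙ DerivedCategory.Q) (Localization.inverts _ W₂) Res hR' α hα⟩
    · exact ⟨loc_left G W₂ (T ⋙ DerivedCategory.Q) Res hR' β hβ,
        arrow_left G W₂ (T ⋙ DerivedCategory.Q) (Localization.inverts _ W₂) Res hR' β hβ⟩
  exact key

end ResolutionPart

section RepPart

open CategoryTheory Limits

/-- Raw representation data. -/
structure Raw (k : Type) [Field k] (ι : Type) (M : ι → ι → Prop) : Type 1 where
  V : ι → ModuleCat.{0} k
  φ : ∀ v w, M v w → (V v →ₗ[k] V w)

variable {k : Type} [Field k] {ι : Type} {M : ι → ι → Prop}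

/-- Morphisms of representations. -/
structure RHom (X Y : Raw k ι M) : Type where
  g : ∀ v, X.V v →ₗ[k] Y.V v
  comm : ∀ v w h x, g w (X.φ v w h x) = Y.φ v w h (g v x)

lemma RHom.ext' {X Y : Raw k ι M} {f g : RHom X Y} (h : ∀ v x, f.g v x = g.g v x) : f = g := by
  obtain ⟨f, hf⟩ := f
  obtain ⟨g, hg⟩ := g
  congr
  funext v
  exact LinearMap.ext (h v)

/-- Representations satisfying the condition `P`. -/
structure QRep (P : Raw k ι M → Prop) : Type 1 where
  raw : Raw k ι M
  prop : P raw

/-- The product of two representations. -/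
def Raw.prod (X Y : Raw k ι M) : Raw k ι M where
  V v := ModuleCat.of k (X.V v × Y.V v)
  φ v w h := (X.φ v w h).prodMap (Y.φ v w h)

/-- The zero representation. -/
def Raw.zero : Raw k ι M where
  V _ := ModuleCat.of k PUnit
  φ _ _ _ := 0

/-- Closure properties of conditions on representations. -/
class PClosed (P : Raw k ι M → Prop) : Prop where
  zero : P Raw.zero
  prod : ∀ X Y, P X → P Y → P (X.prod Y)

variable {P : Raw k ι M → Prop}

instance : Category.{0} (QRep P) where
  Hom X Y := RHom X.raw Y.raw
  id X := ⟨fun _ => LinearMap.id, fun _ _ _ _ => rfl⟩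
  comp f g := ⟨fun v => (g.g v).comp (f.g v), fun v w h x => by
    simp [f.comm, g.comm]⟩

namespace QRep

@[simp] lemma id_g (X : QRep P) (v : ι) (x : X.raw.V v) : RHom.g (𝟙 X : X ⟶ X) v x = x := rfl

@[simp] lemma comp_g {X Y Z : QRep P} (f : X ⟶ Y) (g : Y ⟶ Z) (v : ι) (x : X.raw.V v) :
    RHom.g (f ≫ g) v x = RHom.g g v (RHom.g f v x) := rfl

lemma hom_ext {X Y : QRep P} {f g : X ⟶ Y} (h : ∀ v x, RHom.g f v x = RHom.g g v x) : f = g :=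
  RHom.ext' h

variable {X Y : QRep P}

instance : Zero (X ⟶ Y) := ⟨⟨fun _ => 0, fun _ _ _ _ => by simp⟩⟩
instance : Add (X ⟶ Y) := ⟨fun f g => ⟨fun v => f.g v + g.g v, fun v w h x => by
  simp [f.comm, g.comm]⟩⟩
instance : Neg (X ⟶ Y) := ⟨fun f => ⟨fun v => - f.g v, fun v w h x => by
  simp [f.comm]⟩⟩

@[simp] lemma zero_g (v : ι) (x : X.raw.V v) : RHom.g (0 : X ⟶ Y) v x = 0 := rfl
@[simp] lemma add_g (f g : X ⟶ Y) (v : ι) (x : X.raw.V v) :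
    RHom.g (f + g) v x = RHom.g f v x + RHom.g g v x := rfl
@[simp] lemma neg_g (f : X ⟶ Y) (v : ι) (x : X.raw.V v) :
    RHom.g (- f) v x = - RHom.g f v x := rfl

instance : AddCommGroup (X ⟶ Y) where
  add_assoc f g h := hom_ext fun v x => by simp [add_assoc]
  zero_add f := hom_ext fun v x => by simp
  add_zero f := hom_ext fun v x => by simp
  add_comm f g := hom_ext fun v x => by simp [add_comm]
  neg_add_cancel f := hom_ext fun v x => by simp
  nsmul := nsmulRec
  zsmul := zsmulRec

instance : Preadditive (QRep P) where
  add_comp _ _ _ f g h := hom_ext fun v x => by simp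
  comp_add _ _ _ f g h := hom_ext fun v x => by simp

instance [h : PClosed P] : HasZeroObject (QRep P) where
  zero := ⟨⟨Raw.zero, h.zero⟩, (IsZero.iff_id_eq_zero _).2
    (hom_ext fun v x => Subsingleton.elim (α := PUnit) _ _)⟩

/-- The biproduct of two representations. -/
def bicone [h : PClosed P] (X Y : QRep P) : BinaryBicone X Y where
  pt := ⟨X.raw.prod Y.raw, h.prod _ _ X.prop Y.prop⟩
  fst := ⟨fun v => LinearMap.fst k _ _, fun _ _ _ _ => rfl⟩
  snd := ⟨fun v => LinearMap.snd k _ _, fun _ _ _ _ => rfl⟩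
  inl := ⟨fun v => LinearMap.inl k _ _, fun v w h x => Prod.ext rfl (map_zero (Y.raw.φ v w h)).symm⟩
  inr := ⟨fun v => LinearMap.inr k _ _, fun v w h x => Prod.ext (map_zero (X.raw.φ v w h)).symm rfl⟩
  inl_fst := rfl
  inl_snd := rfl
  inr_fst := rfl
  inr_snd := rfl

instance [h : PClosed P] : HasBinaryBiproducts (QRep P) where
  has_binary_biproduct X Y := HasBinaryBiproduct.mk ⟨bicone X Y, isBinaryBilimitOfTotal _
    (hom_ext fun v x => Prod.ext (add_zero x.1) (zero_add x.2))⟩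

/-- Evaluation at a vertex. -/
def ev (P : Raw k ι M → Prop) (v : ι) : QRep P ⥤ ModuleCat.{0} k where
  obj X := X.raw.V v
  map f := ModuleCat.ofHom (f.g v)

instance (v : ι) : (ev P v).Additive where
  map_add := rfl

end QRep

end RepPart

section ElemPart

open CategoryTheory Limits

variable {R : Type} [Ring R]

lemma shortComplex_quasiIso_elem {S₁ S₂ : ShortComplex (ModuleCat.{0} R)} (φ : S₁ ⟶ S₂) :
    ShortComplex.QuasiIso φ ↔
      (∀ x : S₁.X₂, S₁.g x = 0 → (∃ y : S₂.X₁, S₂.f y = φ.τ₂ x) → ∃ z : S₁.X₁, S₁.f z = x) ∧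
      (∀ y : S₂.X₂, S₂.g y = 0 → ∃ (x : S₁.X₂) (z : S₂.X₁), S₁.g x = 0 ∧ y = φ.τ₂ x + S₂.f z) := by
  let h₁ := S₁.moduleCatLeftHomologyData
  let h₂ := S₂.moduleCatLeftHomologyData
  let γ : ShortComplex.LeftHomologyMapData φ h₁ h₂ := default
  have hi₁ : ∀ x : h₁.K, S₁.g (h₁.i x) = 0 := fun x => x.2
  have hi₂ : ∀ x : h₂.K, S₂.g (h₂.i x) = 0 := fun x => x.2
  have hinj₁ : Function.Injective h₁.i := Subtype.val_injective
  have hinj₂ : Function.Injective h₂.i := Subtype.val_injective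
  have hs₁ : ∀ x : S₁.X₂, S₁.g x = 0 → ∃ y : h₁.K, h₁.i y = x := fun x hx => ⟨⟨x, hx⟩, rfl⟩
  have hs₂ : ∀ x : S₂.X₂, S₂.g x = 0 → ∃ y : h₂.K, h₂.i y = x := fun x hx => ⟨⟨x, hx⟩, rfl⟩
  have hp₁ : Function.Surjective h₁.π := Submodule.mkQ_surjective _
  have hp₂ : Function.Surjective h₂.π := Submodule.mkQ_surjective _
  have hk₁ : ∀ x : h₁.K, h₁.π x = 0 ↔ ∃ z : S₁.X₁, S₁.f z = h₁.i x := fun x => by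
    refine (Submodule.Quotient.mk_eq_zero _).trans ?_
    constructor
    · rintro ⟨z, rfl⟩; exact ⟨z, rfl⟩
    · rintro ⟨z, hz⟩; exact ⟨z, Subtype.ext hz⟩
  have hk₂ : ∀ x : h₂.K, h₂.π x = 0 ↔ ∃ z : S₂.X₁, S₂.f z = h₂.i x := fun x => by
    refine (Submodule.Quotient.mk_eq_zero _).trans ?_
    constructor
    · rintro ⟨z, rfl⟩; exact ⟨z, rfl⟩
    · rintro ⟨z, hz⟩; exact ⟨z, Subtype.ext hz⟩
  have c₁ : ∀ x : h₁.K, γ.φH (h₁.π x) = h₂.π (γ.φK x) := fun x =>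
    ConcreteCategory.congr_hom γ.commπ x
  have c₂ : ∀ x : h₁.K, h₂.i (γ.φK x) = φ.τ₂ (h₁.i x) := fun x =>
    ConcreteCategory.congr_hom γ.commi x
  rw [γ.quasiIso_iff, ConcreteCategory.isIso_iff_bijective]
  clear_value h₁ h₂ γ
  constructor
  · rintro ⟨hI, hS⟩
    constructor
    · rintro x hx ⟨y, hy⟩
      obtain ⟨x, rfl⟩ := hs₁ x hx
      rw [← hk₁]
      apply hI
      rw [c₁, map_zero, hk₂]
      exact ⟨y, by rw [hy, c₂]⟩
    · intro y hy
      obtain ⟨y, rfl⟩ := hs₂ y hy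
      obtain ⟨x, hx⟩ := hS (h₂.π y)
      obtain ⟨x, rfl⟩ := hp₁ x
      have : h₂.π (y - γ.φK x) = 0 := by rw [map_sub, ← c₁, hx, sub_self]
      obtain ⟨z, hz⟩ := (hk₂ _).1 this
      refine ⟨h₁.i x, z, hi₁ x, ?_⟩
      rw [hz, map_sub, c₂]; abel
  · rintro ⟨hI, hS⟩
    constructor
    · rw [injective_iff_map_eq_zero]
      intro x hx
      obtain ⟨x, rfl⟩ := hp₁ x
      rw [c₁, hk₂] at hx
      obtain ⟨z, hz⟩ := hx
      rw [hk₁]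
      exact hI _ (hi₁ x) ⟨z, by rw [hz, c₂]⟩
    · intro y
      obtain ⟨y, rfl⟩ := hp₂ y
      obtain ⟨x, z, hx, hy⟩ := hS _ (hi₂ y)
      obtain ⟨x, rfl⟩ := hs₁ x hx
      refine ⟨h₁.π x, ?_⟩
      rw [c₁, ← sub_eq_zero, ← map_sub, hk₂]
      refine ⟨- z, ?_⟩
      rw [map_sub, c₂, hy, map_neg]; abel

/-- The elementwise quasi-isomorphism criterion. -/
def ElemQ {K L : CochainComplex (ModuleCat.{0} R) ℤ} (f : K ⟶ L) : Prop :=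
  ∀ i j l : ℤ, i + 1 = j → j + 1 = l →
    (∀ x : K.X j, K.d j l x = 0 → (∃ y : L.X i, L.d i j y = f.f j x) → ∃ z : K.X i, K.d i j z = x) ∧
    (∀ y : L.X j, L.d j l y = 0 → ∃ (x : K.X j) (z : L.X i), K.d j l x = 0 ∧
      y = f.f j x + L.d i j z)

lemma quasiIso_elem {K L : CochainComplex (ModuleCat.{0} R) ℤ} (f : K ⟶ L) :
    QuasiIso f ↔ ElemQ f := by
  have key : ∀ i j l : ℤ, i + 1 = j → j + 1 = l → (QuasiIsoAt f j ↔ _) := fun i j l h h' =>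
    (quasiIsoAt_iff' f i j l (by simp; omega) (by simp; omega)).trans
      (shortComplex_quasiIso_elem _)
  rw [quasiIso_iff]
  constructor
  · intro H i j l h h'
    exact (key i j l h h').1 (H j)
  · intro H j
    exact (key (j-1) j (j+1) (by omega) rfl).2 (H (j-1) j (j+1) (by omega) rfl)

end ElemPart

section TotPart

open CategoryTheory Limits

open scoped Classical in
/-- The endomorphism of the total space given by a trivial path. -/
noncomputable def vEnd {k : Type} [Field k] {ι : Type} {M : ι → ι → Prop} (X : Raw k ι M)
    (v : ι) : Module.End k (∀ w, X.V w) :=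
  (LinearMap.single k (fun w => X.V w) v).comp (LinearMap.proj v)

open scoped Classical in
/-- The endomorphism of the total space given by an arrow. -/
noncomputable def arEnd {k : Type} [Field k] {ι : Type} {M : ι → ι → Prop} (X : Raw k ι M)
    (v w : ι) (h : M v w) : Module.End k (∀ w, X.V w) :=
  (LinearMap.single k (fun w => X.V w) w).comp ((X.φ v w h).comp (LinearMap.proj v))

/-- Comparison data between a quiver and the shape of representations. -/
structure TD (k : Type) [Field k] (Q : PreQuiver) (R : Set (List Q.A)) (ι : Type)
    (M : ι → ι → Prop) (P : Raw k ι M → Prop) where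
  σ : Q.V ≃ ι
  hM : ∀ a, M (σ (Q.s a)) (σ (Q.t a))
  surj : ∀ v w, M v w → ∃ a, σ (Q.s a) = v ∧ σ (Q.t a) = w
  inj : ∀ a b, Q.s a = Q.s b → Q.t a = Q.t b → a = b
  hP : ∀ X : Raw k ι M, P X ↔ ∀ p ∈ R, (p.map fun a => MulOpposite.op
    (arEnd X _ _ (hM a))).prod = 0

namespace TD

variable {k : Type} [Field k] {Q : PreQuiver} {R : Set (List Q.A)} {ι : Type}
    {M : ι → ι → Prop} {P : Raw k ι M → Prop} (D : TD k Q R ι M P)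

/-- The action of the generators. -/
noncomputable def gen (X : Raw k ι M) : Q.V ⊕ Q.A → Module.End k (∀ w, X.V w)
  | Sum.inl v => vEnd X (D.σ v)
  | Sum.inr a => arEnd X _ _ (D.hM a)

@[simp] lemma vEnd_same (X : Raw k ι M) (v : ι) (x : ∀ w, X.V w) : vEnd X v x v = x v := by
  simp [vEnd]

lemma vEnd_ne (X : Raw k ι M) (v w : ι) (h : w ≠ v) (x : ∀ w, X.V w) : vEnd X v x w = 0 := by
  simp [vEnd, h]

@[simp] lemma arEnd_same (X : Raw k ι M) (v w : ι) (h : M v w) (x : ∀ w, X.V w) :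
    arEnd X v w h x w = X.φ v w h (x v) := by
  simp [arEnd]

lemma arEnd_ne (X : Raw k ι M) (v w : ι) (h : M v w) (u : ι) (hu : u ≠ w) (x : ∀ w, X.V w) :
    arEnd X v w h x u = 0 := by
  simp [arEnd, hu]

/-- The lift to the free algebra. -/
noncomputable def freeAct (X : Raw k ι M) :
    FreeAlgebra k (Q.V ⊕ Q.A) →ₐ[k] (Module.End k (∀ w, X.V w))ᵐᵒᵖ :=
  FreeAlgebra.lift k fun g => MulOpposite.op (D.gen X g)

@[simp] lemma freeAct_ι (X : Raw k ι M) (g : Q.V ⊕ Q.A) :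
    D.freeAct X (FreeAlgebra.ι k g) = MulOpposite.op (D.gen X g) := by
  simp [freeAct]

lemma freeAct_rel (X : QRep P) ⦃x y : FreeAlgebra k (Q.V ⊕ Q.A)⦄ (h : PathAlgRel k Q R x y) :
    D.freeAct X.raw x = D.freeAct X.raw y := by
  induction h with
  | idem v =>
    simp only [map_mul, freeAct_ι, ← MulOpposite.op_mul]
    congr 1
    ext1 x
    funext w
    by_cases hw : w = D.σ v
    · subst hw; simp [gen]
    · simp [gen, vEnd_ne, hw]
  | orth v w h =>
    simp only [map_mul, freeAct_ι, ← MulOpposite.op_mul, map_zero]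
    rw [← MulOpposite.op_zero]
    congr 1
    ext1 x
    funext u
    by_cases hw : u = D.σ w
    · subst hw
      have : D.σ w ≠ D.σ v := fun e => h (D.σ.injective e.symm)
      simp [gen, vEnd_ne, this]
    · simp [gen, vEnd_ne, hw]
  | unit =>
    simp only [map_sum, freeAct_ι, map_one]
    rw [← Finset.op_sum, ← MulOpposite.op_one]
    congr 1
    ext1 x
    funext u
    obtain ⟨v, rfl⟩ := D.σ.surjective u
    rw [LinearMap.sum_apply, Finset.sum_apply, Finset.sum_eq_single v]
    · simp [gen]
    · intro w _ hw
      have : D.σ v ≠ D.σ w := fun e => hw (D.σ.injective e.symm)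
      simp [gen, vEnd_ne, this]
    · simp
  | source a =>
    simp only [map_mul, freeAct_ι, ← MulOpposite.op_mul]
    congr 1
    ext1 x
    funext w
    by_cases hw : w = D.σ (Q.t a)
    · subst hw; simp [gen]
    · simp [gen, arEnd_ne, hw]
  | target a =>
    simp only [map_mul, freeAct_ι, ← MulOpposite.op_mul]
    congr 1
    ext1 x
    funext w
    by_cases hw : w = D.σ (Q.t a)
    · subst hw; simp [gen]
    · simp [gen, arEnd_ne, vEnd_ne, hw]
  | zeroRel p hp =>
    have := (D.hP X.raw).1 X.prop p hp
    rw [map_list_prod, map_zero, ← this, List.map_map]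
    congr 1
    apply List.map_congr_left
    intro a _
    simp [gen]

/-- The action on the total space. -/
noncomputable def act (X : QRep P) :
    (PathAlgebraRel k Q R)ᵐᵒᵖ →ₐ[k] Module.End k (∀ w, X.raw.V w) :=
  AlgHom.opComm (RingQuot.liftAlgHom k ⟨D.freeAct X.raw, D.freeAct_rel X⟩)

/-- The generators of the path algebra. -/
noncomputable def gn (k : Type) [Field k] (Q : PreQuiver) (R : Set (List Q.A)) (g : Q.V ⊕ Q.A) :
    (PathAlgebraRel k Q R)ᵐᵒᵖ :=
  MulOpposite.op (RingQuot.mkAlgHom k (PathAlgRel k Q R) (FreeAlgebra.ι k g))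

@[simp] lemma act_gn (X : QRep P) (g : Q.V ⊕ Q.A) :
    D.act X (gn k Q R g) = D.gen X.raw g := by
  simp only [act, gn]
  change ((RingQuot.liftAlgHom k ⟨D.freeAct X.raw, D.freeAct_rel X⟩)
    (RingQuot.mkAlgHom k (PathAlgRel k Q R) (FreeAlgebra.ι k g))).unop = _
  rw [RingQuot.liftAlgHom_mkAlgHom_apply]
  simp

lemma gn_induction {p : (PathAlgebraRel k Q R)ᵐᵒᵖ → Prop}
    (h0 : ∀ c : k, p (algebraMap k _ c)) (h1 : ∀ g, p (gn k Q R g))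
    (hmul : ∀ a b, p a → p b → p (a * b)) (hadd : ∀ a b, p a → p b → p (a + b)) (a) : p a := by
  obtain ⟨a, rfl⟩ := MulOpposite.op_surjective a
  obtain ⟨a, rfl⟩ := RingQuot.mkAlgHom_surjective k _ a
  induction a using FreeAlgebra.induction with
  | grade0 c => rw [AlgHom.commutes]; exact h0 c
  | grade1 g => exact h1 g
  | mul a b ha hb => rw [map_mul, MulOpposite.op_mul]; exact hmul _ _ hb ha
  | add a b ha hb => rw [map_add, MulOpposite.op_add]; exact hadd _ _ ha hb

lemma gn_rel {x y : FreeAlgebra k (Q.V ⊕ Q.A)} (h : PathAlgRel k Q R x y) :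
    MulOpposite.op (RingQuot.mkAlgHom k (PathAlgRel k Q R) x) =
    MulOpposite.op (RingQuot.mkAlgHom k (PathAlgRel k Q R) y) := by
  rw [RingQuot.mkAlgHom_rel k h]

/-- The total space of a representation. -/
def T (_ : TD k Q R ι M P) (X : QRep P) : Type := ∀ w, X.raw.V w

instance (X : QRep P) : AddCommGroup (D.T X) := inferInstanceAs (AddCommGroup (∀ w, X.raw.V w))

noncomputable instance (X : QRep P) : Module (PathAlgebraRel k Q R)ᵐᵒᵖ (D.T X) :=
  Module.compHom (∀ w, X.raw.V w) (D.act X).toRingHom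

lemma smul_def (X : QRep P) (a : (PathAlgebraRel k Q R)ᵐᵒᵖ) (x : D.T X) :
    a • x = D.act X a x := rfl

/-- The action of morphisms on total spaces. -/
def tmap {X Y : QRep P} (f : X ⟶ Y) (x : D.T X) : D.T Y := fun w => RHom.g f w (x w)

lemma gen_nat {X Y : QRep P} (f : X ⟶ Y) (g : Q.V ⊕ Q.A) (x : ∀ w, X.raw.V w) :
    (fun w => RHom.g f w (D.gen X.raw g x w)) = D.gen Y.raw g (fun w => RHom.g f w (x w)) := by
  funext w
  rcases g with v | a
  · by_cases hw : w = D.σ v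
    · subst hw; simp [gen]
    · simp [gen, vEnd_ne, hw]
  · by_cases hw : w = D.σ (Q.t a)
    · subst hw; simp [gen, RHom.comm]
    · simp [gen, arEnd_ne, hw]

lemma tmap_smul {X Y : QRep P} (f : X ⟶ Y) (a : (PathAlgebraRel k Q R)ᵐᵒᵖ) :
    ∀ x : D.T X, D.tmap f (a • x) = a • D.tmap f x := by
  induction a using gn_induction with
  | h0 c =>
    intro x
    simp only [smul_def, AlgHom.commutes, Module.algebraMap_end_apply]
    funext w
    exact map_smul (RHom.g f w) c (x w)
  | h1 g =>
    intro x
    simp only [smul_def, act_gn]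
    exact D.gen_nat f g x
  | hmul a b ha hb =>
    intro x
    rw [mul_smul, ha, hb, mul_smul]
  | hadd a b ha hb =>
    intro x
    have h : D.tmap f (a • x + b • x) = D.tmap f (a • x) + D.tmap f (b • x) :=
      funext fun w => map_add (RHom.g f w) _ _
    rw [add_smul, h, ha, hb, add_smul]

/-- The functor from representations to modules over the path algebra. -/
noncomputable def tot : QRep P ⥤ ModuleCat.{0} (PathAlgebraRel k Q R)ᵐᵒᵖ where
  obj X := ModuleCat.of _ (D.T X)
  map {X Y} f := ModuleCat.ofHom
    { toFun := D.tmap f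
      map_add' := fun x y => funext fun w => map_add (RHom.g f w) (x w) (y w)
      map_smul' := fun a x => D.tmap_smul f a x }

lemma tot_map_apply {X Y : QRep P} (f : X ⟶ Y) (x : D.T X) (w : ι) :
    (D.tot.map f x : D.T Y) w = RHom.g f w (x w) := rfl

instance : D.tot.Additive where
  map_add := rfl

instance : D.tot.Faithful where
  map_injective {X Y} f g h := by
    classical
    apply QRep.hom_ext
    intro v x
    have h1 := ConcreteCategory.congr_hom h (Pi.single v x : ∀ w, X.raw.V w)
    have h2 : RHom.g f v ((Pi.single v x : ∀ w, X.raw.V w) v) =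
      RHom.g g v ((Pi.single v x : ∀ w, X.raw.V w) v) := congrFun h1 v
    simpa using h2

instance : D.tot.Full where
  map_surjective {X Y} G := by
    classical
    let G' : (∀ w, X.raw.V w) → (∀ w, Y.raw.V w) := fun x => G.hom (x : D.T X)
    have hadd : ∀ x y, G' (x + y) = G' x + G' y := fun x y => map_add G.hom x y
    have hact : ∀ (a : (PathAlgebraRel k Q R)ᵐᵒᵖ) x, G' (D.act X a x) = D.act Y a (G' x) :=
      fun a x => map_smul G.hom a (show D.T X from x)
    have hsm : ∀ (c : k) x, G' (c • x) = c • G' x := fun c x => by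
      have := hact (algebraMap k _ c) x
      simpa only [AlgHom.commutes, Module.algebraMap_end_apply] using this
    have hg : ∀ g x, G' (D.gen X.raw g x) = D.gen Y.raw g (G' x) := fun g x => by
      simpa using hact (gn k Q R g) x
    have hv : ∀ v x, G' (vEnd X.raw v x) = vEnd Y.raw v (G' x) := fun v x => by
      obtain ⟨v, rfl⟩ := D.σ.surjective v
      exact hg (Sum.inl v) x
    have hsing : ∀ v (x : ∀ w, X.raw.V w), vEnd X.raw v x = Pi.single v (x v) := fun v x => rfl
    have har : ∀ v w h x, G' (arEnd X.raw v w h x) = arEnd Y.raw v w h (G' x) := fun v w h x => by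
      obtain ⟨a, rfl, rfl⟩ := D.surj v w h
      exact hg (Sum.inr a) x
    have hcomp : ∀ v x, G' x v = G' (Pi.single v (x v)) v := fun v x => by
      rw [← hsing, hv, vEnd_same]
    refine ⟨⟨fun v => 
      { toFun := fun x => G' (Pi.single v x) v
        map_add' := fun x y => by rw [Pi.single_add, hadd]; rfl
        map_smul' := fun c x => by rw [Pi.single_smul, hsm]; rfl }, ?_⟩, ?_⟩
    · intro v w h x
      have h1 := congrFun (har v w h (Pi.single v x)) w
      rw [arEnd_same, hcomp, arEnd_same, Pi.single_eq_same] at h1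
      exact h1
    · apply ModuleCat.hom_ext
      apply LinearMap.ext
      intro x
      funext w
      exact (hcomp w x).symm

end TD
end TotPart

section TotEss

open CategoryTheory Limits

namespace TD

variable {k : Type} [Field k] {Q : PreQuiver} {R : Set (List Q.A)} {ι : Type}
    {M : ι → ι → Prop} {P : Raw k ι M → Prop} (D : TD k Q R ι M P)

lemma gn_idem (v : Q.V) : gn k Q R (Sum.inl v) * gn k Q R (Sum.inl v) = gn k Q R (Sum.inl v) := by
  have := gn_rel (PathAlgRel.idem (k := k) (R := R) v)
  rwa [map_mul] at this

lemma gn_orth (v w : Q.V) (h : v ≠ w) : gn k Q R (Sum.inl v) * gn k Q R (Sum.inl w) = 0 := by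
  have := gn_rel (PathAlgRel.orth (k := k) (R := R) w v h.symm)
  rwa [map_mul, map_zero] at this

lemma gn_unit : ∑ v, gn k Q R (Sum.inl v) = 1 := by
  have := gn_rel (PathAlgRel.unit (k := k) (Q := Q) (R := R))
  rwa [map_sum, Finset.op_sum, map_one] at this

lemma gn_source (a : Q.A) : gn k Q R (Sum.inr a) * gn k Q R (Sum.inl (Q.s a)) =
    gn k Q R (Sum.inr a) := by
  have := gn_rel (PathAlgRel.source (k := k) (R := R) a)
  rwa [map_mul] at this

lemma gn_target (a : Q.A) : gn k Q R (Sum.inl (Q.t a)) * gn k Q R (Sum.inr a) =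
    gn k Q R (Sum.inr a) := by
  have := gn_rel (PathAlgRel.target (k := k) (R := R) a)
  rwa [map_mul] at this

variable (N : Type) [AddCommGroup N] [Module (PathAlgebraRel k Q R)ᵐᵒᵖ N] [Module k N]
  [IsScalarTower k (PathAlgebraRel k Q R)ᵐᵒᵖ N]

/-- The component of a module at a vertex. -/
noncomputable def NV (w : ι) : Submodule k N where
  carrier := {x | gn k Q R (Sum.inl (D.σ.symm w)) • x = x}
  add_mem' {x y} hx hy := by
    simp only [Set.mem_setOf_eq] at *
    rw [smul_add, hx, hy]
  zero_mem' := smul_zero _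
  smul_mem' c x hx := by
    simp only [Set.mem_setOf_eq] at *
    haveI : SMulCommClass k (PathAlgebraRel k Q R)ᵐᵒᵖ N := IsScalarTower.to_smulCommClass
    rw [smul_comm, hx]

lemma NV_mem (v : Q.V) (x : N) : x ∈ D.NV N (D.σ v) ↔ gn k Q R (Sum.inl v) • x = x := by
  change gn k Q R (Sum.inl (D.σ.symm (D.σ v))) • x = x ↔ _
  rw [Equiv.symm_apply_apply]

lemma ar_mem (a : Q.A) (w : ι) (h : D.σ (Q.t a) = w) (x : N) :
    gn k Q R (Sum.inr a) • x ∈ D.NV N w := by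
  subst h
  rw [NV_mem, ← mul_smul, gn_target]

/-- The representation associated to a module. -/
noncomputable def nraw : Raw k ι M where
  V w := ModuleCat.of k (D.NV N w)
  φ v w h :=
    { toFun := fun x => ⟨gn k Q R (Sum.inr (D.surj v w h).choose) • (x : N), by
        exact D.ar_mem N _ w (D.surj v w h).choose_spec.2 x⟩
      map_add' := fun x y => Subtype.ext (smul_add _ _ _)
      map_smul' := fun c x => Subtype.ext (by
        haveI : SMulCommClass k (PathAlgebraRel k Q R)ᵐᵒᵖ N := IsScalarTower.to_smulCommClass
        exact smul_comm _ _ _) }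

lemma nraw_φ (a : Q.A) (h) (x : D.NV N (D.σ (Q.s a))) :
    ((show D.NV N (D.σ (Q.t a)) from (D.nraw N).φ _ (D.σ (Q.t a)) h x) : N) =
    gn k Q R (Sum.inr a) • (x : N) := by
  have hs := (D.surj _ _ h).choose_spec
  have : (D.surj _ _ h).choose = a :=
    D.inj _ _ (D.σ.injective hs.1) (D.σ.injective hs.2)
  have h2 : ∀ b, b = a → gn k Q R (Sum.inr b) • (x : N) = gn k Q R (Sum.inr a) • (x : N) := by
    rintro b rfl; rfl
  exact h2 _ this

/-- The comparison map. -/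
noncomputable def nS (x : ∀ w, (D.nraw N).V w) : N :=
  ∑ v, ((show D.NV N (D.σ v) from x (D.σ v)) : N)

lemma e_smul_nS (v : Q.V) (x : ∀ w, (D.nraw N).V w) :
    gn k Q R (Sum.inl v) • D.nS N x = (show D.NV N (D.σ v) from x (D.σ v)).1 := by
  rw [nS, Finset.smul_sum, Finset.sum_eq_single v]
  · exact (D.NV_mem N v _).1 (x (D.σ v)).2
  · intro w _ hw
    rw [← (D.NV_mem N w _).1 (x (D.σ w)).2, ← mul_smul, gn_orth _ _ hw.symm, zero_smul]
  · simp

lemma nS_add (x y : ∀ w, (D.nraw N).V w) : D.nS N (x + y) = D.nS N x + D.nS N y := by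
  simp only [nS, ← Finset.sum_add_distrib]
  rfl

lemma nS_smul (c : k) (x : ∀ w, (D.nraw N).V w) : D.nS N (c • x) = c • D.nS N x := by
  simp only [nS, Finset.smul_sum]
  rfl

lemma nS_inj (x y : ∀ w, (D.nraw N).V w) (h : D.nS N x = D.nS N y) : x = y := by
  funext w
  obtain ⟨v, rfl⟩ := D.σ.surjective w
  apply Subtype.ext
  exact (D.e_smul_nS N v x).symm.trans (h ▸ D.e_smul_nS N v y)

lemma nS_surj (n : N) : ∃ x, D.nS N x = n := by
  refine ⟨fun w => ⟨gn k Q R (Sum.inl (D.σ.symm w)) • n, ?_⟩, ?_⟩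
  · change gn k Q R (Sum.inl (D.σ.symm w)) • (gn k Q R (Sum.inl (D.σ.symm w)) • n) = _
    rw [← mul_smul, gn_idem]
  · simp only [nS, Equiv.symm_apply_apply]
    rw [← Finset.sum_smul, gn_unit, one_smul]

lemma nS_gen (g : Q.V ⊕ Q.A) (x : ∀ w, (D.nraw N).V w) :
    D.nS N (D.gen (D.nraw N) g x) = gn k Q R g • D.nS N x := by
  rcases g with v | a
  · rw [e_smul_nS, nS, Finset.sum_eq_single v]
    · simp [gen]
    · intro w _ hw
      have : D.σ w ≠ D.σ v := fun e => hw (D.σ.injective e)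
      simp [gen, vEnd_ne, this]
      rfl
    · simp
  · rw [← gn_source, mul_smul, e_smul_nS, nS, Finset.sum_eq_single (Q.t a)]
    · rw [← D.nraw_φ N a (D.hM a)]
      simp [gen]
    · intro w _ hw
      have : D.σ w ≠ D.σ (Q.t a) := fun e => hw (D.σ.injective e)
      simp [gen, arEnd_ne, this]
      rfl
    · simp

lemma nS_list (p : List Q.A) : ∀ (x : ∀ w, (D.nraw N).V w),
    D.nS N ((p.map fun a => MulOpposite.op (arEnd (D.nraw N) _ _ (D.hM a))).prod.unop x) =
    MulOpposite.op (RingQuot.mkAlgHom k (PathAlgRel k Q R)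
      ((p.map fun a => FreeAlgebra.ι k (Sum.inr a)).prod)) • D.nS N x := by
  induction p with
  | nil => intro x; simp
  | cons a p ih =>
    intro x
    rw [List.map_cons, List.prod_cons, List.map_cons, List.prod_cons, map_mul,
      MulOpposite.op_mul, mul_smul]
    have := D.nS_gen N (Sum.inr a) x
    rw [gn] at this
    rw [← this, ← ih]
    rfl

lemma nraw_prop : P (D.nraw N) := by
  rw [D.hP]
  intro p hp
  apply MulOpposite.unop_injective
  apply LinearMap.ext
  intro x
  apply D.nS_inj N
  rw [nS_list, gn_rel (PathAlgRel.zeroRel p hp), map_zero, MulOpposite.op_zero, zero_smul]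
  have := D.nS_smul N 0 0
  rw [zero_smul, zero_smul] at this
  exact this.symm

lemma nS_act (a : (PathAlgebraRel k Q R)ᵐᵒᵖ) : ∀ (x : ∀ w, (D.nraw N).V w),
    D.nS N (D.act ⟨D.nraw N, D.nraw_prop N⟩ a x) = a • D.nS N x := by
  induction a using gn_induction with
  | h0 c =>
    intro x
    rw [AlgHom.commutes, Module.algebraMap_end_apply, algebraMap_smul]
    exact D.nS_smul N c x
  | h1 g =>
    intro x
    rw [act_gn]
    exact D.nS_gen N g x
  | hmul a b ha hb =>
    intro x
    rw [map_mul, mul_smul, ← hb, ← ha]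
    rfl
  | hadd a b ha hb =>
    intro x
    rw [map_add, add_smul, ← ha, ← hb]
    exact D.nS_add N _ _

instance : D.tot.EssSurj where
  mem_essImage N := by
    letI : Module k N := Module.compHom N (algebraMap k (PathAlgebraRel k Q R)ᵐᵒᵖ)
    haveI : IsScalarTower k (PathAlgebraRel k Q R)ᵐᵒᵖ N := ⟨fun c a n => by
      rw [Algebra.smul_def, mul_smul]; rfl⟩
    let X : QRep P := ⟨D.nraw N, D.nraw_prop N⟩
    let f : D.T X →ₗ[(PathAlgebraRel k Q R)ᵐᵒᵖ] N :=
      { toFun := D.nS N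
        map_add' := D.nS_add N
        map_smul' := D.nS_act N }
    exact ⟨X, ⟨LinearEquiv.toModuleIso (LinearEquiv.ofBijective f
      ⟨fun x y h => D.nS_inj N x y h, fun n => D.nS_surj N n⟩)⟩⟩

instance : D.tot.IsEquivalence where

lemma elem_ev {K L : CochainComplex (QRep P) ℤ} (f : K ⟶ L) (v : ι) :
    QuasiIso (((QRep.ev P v).mapHomologicalComplex _).map f) ↔
    ∀ i j l : ℤ, i + 1 = j → j + 1 = l →
      (∀ x : (K.X j).raw.V v, RHom.g (K.d j l) v x = 0 →
        (∃ y : (L.X i).raw.V v, RHom.g (L.d i j) v y = RHom.g (f.f j) v x) →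
          ∃ z : (K.X i).raw.V v, RHom.g (K.d i j) v z = x) ∧
      (∀ y : (L.X j).raw.V v, RHom.g (L.d j l) v y = 0 →
        ∃ (x : (K.X j).raw.V v) (z : (L.X i).raw.V v), RHom.g (K.d j l) v x = 0 ∧
          y = RHom.g (f.f j) v x + RHom.g (L.d i j) v z) :=
  quasiIso_elem _

lemma elem_tot {K L : CochainComplex (QRep P) ℤ} (f : K ⟶ L) :
    QuasiIso ((D.tot.mapHomologicalComplex _).map f) ↔
    ∀ i j l : ℤ, i + 1 = j → j + 1 = l →
      (∀ x : (∀ v, (K.X j).raw.V v), (fun v => RHom.g (K.d j l) v (x v)) = 0 →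
        (∃ y : (∀ v, (L.X i).raw.V v),
          (fun v => RHom.g (L.d i j) v (y v)) = (fun v => RHom.g (f.f j) v (x v))) →
          ∃ z : (∀ v, (K.X i).raw.V v), (fun v => RHom.g (K.d i j) v (z v)) = x) ∧
      (∀ y : (∀ v, (L.X j).raw.V v), (fun v => RHom.g (L.d j l) v (y v)) = 0 →
        ∃ (x : ∀ v, (K.X j).raw.V v) (z : ∀ v, (L.X i).raw.V v),
          (fun v => RHom.g (K.d j l) v (x v)) = 0 ∧
          y = (fun v => RHom.g (f.f j) v (x v)) + (fun v => RHom.g (L.d i j) v (z v))) :=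
  quasiIso_elem _

lemma quasiIso_tot {K L : CochainComplex (QRep P) ℤ} (f : K ⟶ L) :
    QuasiIso ((D.tot.mapHomologicalComplex _).map f) ↔
    ∀ v, QuasiIso (((QRep.ev P v).mapHomologicalComplex _).map f) := by
  classical
  simp only [elem_ev, elem_tot]
  constructor
  · intro h v i j l hij hjl
    obtain ⟨h1, h2⟩ := h i j l hij hjl
    have hs : ∀ {X Y : QRep P} (f : X ⟶ Y) (x : X.raw.V v),
        (fun w => RHom.g f w ((Pi.single v x : ∀ w, X.raw.V w) w)) = Pi.single v (RHom.g f v x) :=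
      fun f x => funext fun w => Pi.apply_single (fun w => RHom.g f w) (fun w => map_zero _) v x w
    constructor
    · rintro x hx ⟨y, hy⟩
      obtain ⟨z, hz⟩ := h1 (Pi.single v x) (by rw [hs, hx, Pi.single_zero])
        ⟨Pi.single v y, by rw [hs, hs, hy]⟩
      refine ⟨z v, ?_⟩
      have := congrFun hz v
      rwa [Pi.single_eq_same] at this
    · intro y hy
      obtain ⟨x, z, hx, hz⟩ := h2 (Pi.single v y) (by rw [hs, hy, Pi.single_zero])
      refine ⟨x v, z v, congrFun hx v, ?_⟩
      have := congrFun hz v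
      rwa [Pi.single_eq_same] at this
  · intro h i j l hij hjl
    constructor
    · rintro x hx ⟨y, hy⟩
      choose z hz using fun v => (h v i j l hij hjl).1 (x v) (congrFun hx v) ⟨y v, congrFun hy v⟩
      exact ⟨z, funext hz⟩
    · intro y hy
      choose x z hx hz using fun v => (h v i j l hij hjl).2 (y v) (congrFun hy v)
      exact ⟨x, z, funext hx, funext hz⟩

end TD
end TotEss

section ResPart

open CategoryTheory Limits

variable {k : Type} [Field k] {ι : Type} {M : ι → ι → Prop} {P : Raw k ι M → Prop}

/-- The data for a resolution: contractible summands and correction terms. -/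
structure RD (k ι : Type) where
  S : ι → Prop
  A : ι → ι → k
  B : ι → ι → k
  J : ι → ι → k

namespace RD

/-- The product of all components of a complex. -/
abbrev Tt (Y : CochainComplex (QRep P) ℤ) : Type := ∀ p : ℤ × ι, (Y.X p.1).raw.V p.2

/-- The term of the contractible complex. -/
abbrev Cc (Y : CochainComplex (QRep P) ℤ) : Type := Tt Y × Tt Y

/-- The differential of the contractible complex. -/
noncomputable def dC (Y : CochainComplex (QRep P) ℤ) (i j : ℤ) : Cc Y →ₗ[k] Cc Y :=
  if i + 1 = j then (LinearMap.inl k _ _).comp (LinearMap.snd k _ _) else 0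

lemma dC_rel (Y : CochainComplex (QRep P) ℤ) {i j : ℤ} (h : i + 1 = j) (c : Cc Y) :
    dC Y i j c = (c.2, 0) := by
  simp [dC, h]

lemma dC_not (Y : CochainComplex (QRep P) ℤ) {i j : ℤ} (h : ¬ i + 1 = j) :
    dC Y i j = 0 := by
  simp [dC, h]

lemma d_not (Y : CochainComplex (QRep P) ℤ) {i j : ℤ} (h : ¬ i + 1 = j) (v : ι)
    (x : (Y.X i).raw.V v) : RHom.g (Y.d i j) v x = 0 := by
  rw [Y.shape i j h]; rfl

lemma d_d (Y : CochainComplex (QRep P) ℤ) (i j l : ℤ) (v : ι)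
    (x : (Y.X i).raw.V v) : RHom.g (Y.d j l) v (RHom.g (Y.d i j) v x) = 0 := by
  rw [← QRep.comp_g, Y.d_comp_d]; rfl

lemma f_d {Y Z : CochainComplex (QRep P) ℤ} (f : Y ⟶ Z) (i j : ℤ) (v : ι)
    (x : (Y.X i).raw.V v) : RHom.g (f.f j) v (RHom.g (Y.d i j) v x) =
      RHom.g (Z.d i j) v (RHom.g (f.f i) v x) := by
  rw [← QRep.comp_g, ← QRep.comp_g, f.comm]

/-- The projection from the contractible complex. -/
noncomputable def pr (Y : CochainComplex (QRep P) ℤ) (n : ℤ) (w : ι) :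
    Cc Y →ₗ[k] (Y.X n).raw.V w :=
  ((LinearMap.proj (R := k) (φ := fun p : ℤ × ι => (Y.X p.1).raw.V p.2) (n, w)).comp
    (LinearMap.snd k _ _)) +
  ((RHom.g (Y.d (n - 1) n) w).comp
    ((LinearMap.proj (R := k) (φ := fun p : ℤ × ι => (Y.X p.1).raw.V p.2) (n - 1, w)).comp
      (LinearMap.fst k _ _)))

lemma pr_apply (Y : CochainComplex (QRep P) ℤ) (n : ℤ) (w : ι) (c : Cc Y) :
    pr Y n w c = c.2 (n, w) + RHom.g (Y.d (n - 1) n) w (c.1 (n - 1, w)) := rfl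

lemma pr_apply' (Y : CochainComplex (QRep P) ℤ) (m n : ℤ) (h : m + 1 = n) (w : ι) (c : Cc Y) :
    pr Y n w c = c.2 (n, w) + RHom.g (Y.d m n) w (c.1 (m, w)) := by
  obtain rfl : m = n - 1 := by omega
  rfl

lemma pr_d (Y : CochainComplex (QRep P) ℤ) (i j : ℤ) (w : ι) (c : Cc Y) :
    RHom.g (Y.d i j) w (pr Y i w c) = pr Y j w (dC Y i j c) := by
  by_cases h : i + 1 = j
  · rw [dC_rel Y h, pr_apply' Y i j h, pr_apply, map_add, d_d]
    simp
  · rw [d_not Y h, dC_not Y h]; simp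

open scoped Classical in
/-- The inclusion in the contractible complex. -/
noncomputable def jn (Y : CochainComplex (QRep P) ℤ) (n : ℤ) (v : ι) :
    (Y.X n).raw.V v →ₗ[k] Cc Y :=
  (LinearMap.single k (fun p : ℤ × ι => (Y.X p.1).raw.V p.2) (n, v)).prod
    ((LinearMap.single k (fun p : ℤ × ι => (Y.X p.1).raw.V p.2) (n + 1, v)).comp
      (RHom.g (Y.d n (n + 1)) v))

open scoped Classical in
lemma jn_apply (Y : CochainComplex (QRep P) ℤ) (n : ℤ) (v : ι) (y : (Y.X n).raw.V v) :
    jn Y n v y = ((Pi.single (M := fun p : ℤ × ι => (Y.X p.1).raw.V p.2) (n, v) y : Tt Y),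
      (Pi.single (M := fun p : ℤ × ι => (Y.X p.1).raw.V p.2) (n + 1, v)
        (RHom.g (Y.d n (n + 1)) v y) : Tt Y)) := rfl

lemma jn_d (Y : CochainComplex (QRep P) ℤ) (i j : ℤ) (v : ι) (y : (Y.X i).raw.V v) :
    dC Y i j (jn Y i v y) = jn Y j v (RHom.g (Y.d i j) v y) := by
  by_cases h : i + 1 = j
  · subst h
    rw [dC_rel Y rfl, jn_apply, jn_apply, d_d]
    simp
  · rw [d_not Y h, dC_not Y h]; simp

lemma jn_inj (Y : CochainComplex (QRep P) ℤ) (n : ℤ) (v : ι) (y : (Y.X n).raw.V v)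
    (h : jn Y n v y = 0) : y = 0 := by
  classical
  rw [jn_apply] at h
  have := congrFun (congrArg Prod.fst h) (n, v)
  dsimp only at this
  rw [Pi.single_eq_same] at this
  exact this

lemma pr_surj (Y : CochainComplex (QRep P) ℤ) (n : ℤ) (w : ι) (y : (Y.X n).raw.V w) :
    ∃ c, pr Y n w c = y := by
  classical
  refine ⟨((0 : Tt Y), (Pi.single (M := fun p : ℤ × ι => (Y.X p.1).raw.V p.2) (n, w) y : Tt Y)), ?_⟩
  rw [pr_apply]
  dsimp only
  rw [Pi.single_eq_same]
  simp

/-- The action of morphisms on the contractible complex. -/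
def mT {Y Z : CochainComplex (QRep P) ℤ} (f : Y ⟶ Z) : Tt Y →ₗ[k] Tt Z where
  toFun x := fun p => RHom.g (f.f p.1) p.2 (x p)
  map_add' x y := funext fun p => map_add _ _ _
  map_smul' x y := funext fun p => map_smul _ _ _

/-- The action of morphisms on the contractible complex. -/
def mC {Y Z : CochainComplex (QRep P) ℤ} (f : Y ⟶ Z) : Cc Y →ₗ[k] Cc Z :=
  (mT f).prodMap (mT f)

lemma mC_d {Y Z : CochainComplex (QRep P) ℤ} (f : Y ⟶ Z) (i j : ℤ) (c : Cc Y) :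
    mC f (dC Y i j c) = dC Z i j (mC f c) := by
  by_cases h : i + 1 = j
  · rw [dC_rel Y h, dC_rel Z h]
    simp [mC]
  · rw [dC_not Y h, dC_not Z h]; simp

lemma mC_pr {Y Z : CochainComplex (QRep P) ℤ} (f : Y ⟶ Z) (n : ℤ) (w : ι) (c : Cc Y) :
    RHom.g (f.f n) w (pr Y n w c) = pr Z n w (mC f c) := by
  rw [pr_apply, pr_apply, map_add, f_d]
  rfl

lemma mT_single [DecidableEq (ℤ × ι)] {Y Z : CochainComplex (QRep P) ℤ} (f : Y ⟶ Z) (n : ℤ) (v : ι)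
    (y : (Y.X n).raw.V v) :
    mT f (Pi.single (M := fun p : ℤ × ι => (Y.X p.1).raw.V p.2) (n, v) y : Tt Y) =
      Pi.single (M := fun p : ℤ × ι => (Z.X p.1).raw.V p.2) (n, v) (RHom.g (f.f n) v y) :=
  funext fun w => Pi.apply_single (fun p : ℤ × ι => RHom.g (f.f p.1) p.2)
    (fun w => map_zero _) (n, v) y w

lemma mC_jn {Y Z : CochainComplex (QRep P) ℤ} (f : Y ⟶ Z) (n : ℤ) (v : ι)
    (y : (Y.X n).raw.V v) :
    mC f (jn Y n v y) = jn Z n v (RHom.g (f.f n) v y) := by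
  classical
  rw [jn_apply, jn_apply, ← f_d, ← mT_single, ← mT_single]
  rfl

variable (δ : RD k ι)

/-- The component of the contractible complex at a vertex. -/
abbrev Cv (Y : CochainComplex (QRep P) ℤ) (v : ι) : Type := PLift (δ.S v) → Cc Y

/-- Insertion. -/
def ee (Y : CochainComplex (QRep P) ℤ) (v : ι) : Cc Y →ₗ[k] δ.Cv Y v :=
  LinearMap.pi fun _ => LinearMap.id

open scoped Classical in
/-- Extraction. -/
noncomputable def rr (Y : CochainComplex (QRep P) ℤ) (v : ι) : δ.Cv Y v →ₗ[k] Cc Y :=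
  if h : δ.S v then LinearMap.proj (R := k) (φ := fun _ : PLift (δ.S v) => Cc Y) ⟨h⟩ else 0

lemma ee_rr (Y : CochainComplex (QRep P) ℤ) (v : ι) (c : δ.Cv Y v) :
    δ.ee Y v (δ.rr Y v c) = c := by
  funext ⟨h⟩
  simp [ee, rr, h]

lemma rr_ee (Y : CochainComplex (QRep P) ℤ) (v : ι) (h : δ.S v) (c : Cc Y) :
    δ.rr Y v (δ.ee Y v c) = c := by
  simp [ee, rr, h]

lemma rr_nat {Y Z : CochainComplex (QRep P) ℤ} (g : Cc Y →ₗ[k] Cc Z) (v : ι) (c : δ.Cv Y v) :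
    δ.rr Z v (fun p => g (c p)) = g (δ.rr Y v c) := by
  by_cases h : δ.S v <;> simp [rr, h]

/-- The raw representation at degree `n`. -/
noncomputable def raw (Y : CochainComplex (QRep P) ℤ) (n : ℤ) : Raw k ι M where
  V v := ModuleCat.of k ((Y.X n).raw.V v × δ.Cv Y v)
  φ v w h :=
    ((((Y.X n).raw.φ v w h).comp (LinearMap.fst k _ _)) +
      δ.A v w • ((pr Y n w).comp ((δ.rr Y v).comp (LinearMap.snd k _ _)))).prod
    ((δ.ee Y w).comp (δ.B v w • ((δ.rr Y v).comp (LinearMap.snd k _ _)) +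
      δ.J v w • ((jn Y n v).comp (LinearMap.fst k _ _))))

lemma raw_φ (Y : CochainComplex (QRep P) ℤ) (n : ℤ) (v w : ι) (h : M v w)
    (y : (Y.X n).raw.V v) (c : δ.Cv Y v) :
    (δ.raw Y n).φ v w h (y, c) = ((Y.X n).raw.φ v w h y + δ.A v w • pr Y n w (δ.rr Y v c),
      δ.ee Y w (δ.B v w • δ.rr Y v c + δ.J v w • jn Y n v y)) := rfl

/-- Induced maps. -/
def hom {Y Z : CochainComplex (QRep P) ℤ} (m n : ℤ) (f : Y.X m ⟶ Z.X n) (g : Cc Y →ₗ[k] Cc Z)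
    (h1 : ∀ w c, RHom.g f w (pr Y m w c) = pr Z n w (g c))
    (h2 : ∀ v y, g (jn Y m v y) = jn Z n v (RHom.g f v y)) :
    RHom (δ.raw Y m) (δ.raw Z n) where
  g v := (RHom.g f v).prodMap (LinearMap.pi fun p => g.comp (LinearMap.proj p))
  comm v w h x := by
    obtain ⟨y, c⟩ := x
    refine Prod.ext ?_ ?_
    · change RHom.g f w ((Y.X m).raw.φ v w h y + δ.A v w • pr Y m w (δ.rr Y v c)) =
        (Z.X n).raw.φ v w h (RHom.g f v y) +
          δ.A v w • pr Z n w (δ.rr Z v (fun p => g (c p)))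
      rw [map_add, map_smul, rr_nat, h1, RHom.comm]
    · change (fun p => g (δ.B v w • δ.rr Y v c + δ.J v w • jn Y m v y)) =
        δ.ee Z w (δ.B v w • δ.rr Z v (fun p => g (c p)) + δ.J v w • jn Z n v (RHom.g f v y))
      rw [rr_nat, ← h2]
      simp only [map_add, map_smul]
      rfl

variable (hP : ∀ (Y : CochainComplex (QRep P) ℤ) (n : ℤ), P (δ.raw Y n))

/-- The resolution functor. -/
noncomputable def Res : CochainComplex (QRep P) ℤ ⥤ CochainComplex (QRep P) ℤ where
  obj Y :=
    { X := fun n => ⟨δ.raw Y n, hP Y n⟩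
      d := fun i j => δ.hom i j (Y.d i j) (dC Y i j) (pr_d Y i j) (jn_d Y i j)
      shape := fun i j h => RHom.ext' (X := δ.raw Y i) (Y := δ.raw Y j) fun v x => by
        obtain ⟨y, c⟩ := x
        refine Prod.ext (d_not Y h v y) (funext fun p => ?_)
        change dC Y i j (c p) = 0
        rw [dC_not Y h]; rfl
      d_comp_d' := fun i j l hij hjl => RHom.ext' (X := δ.raw Y i) (Y := δ.raw Y l) fun v x => by
        obtain ⟨y, c⟩ := x
        refine Prod.ext (d_d Y i j l v y) (funext fun p => ?_)
        change dC Y j l (dC Y i j (c p)) = 0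
        rw [dC_rel Y hij, dC_rel Y hjl]; rfl }
  map {Y Z} f :=
    { f := fun n => δ.hom n n (f.f n) (mC f) (mC_pr f n) (mC_jn f n)
      comm' := fun i j hij => RHom.ext' (X := δ.raw Y i) (Y := δ.raw Z j) fun v x => by
        obtain ⟨y, c⟩ := x
        refine Prod.ext (f_d f i j v y).symm (funext fun p => ?_)
        exact (mC_d f i j (c p)).symm }
  map_id Y := by
    ext n
    exact QRep.hom_ext fun v x => rfl
  map_comp f g := by
    ext n
    exact QRep.hom_ext fun v x => rfl

/-- The comparison map into the resolution. -/
noncomputable def α (hJ : δ.J = 0) : 𝟭 _ ⟶ δ.Res hP where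
  app Y :=
    { f := fun n => ⟨fun v => LinearMap.inl k _ _, fun v w h x => by
        change _ = (δ.raw Y n).φ v w h (x, 0)
        rw [raw_φ, hJ]
        simp
        rfl⟩
      comm' := fun i j hij => QRep.hom_ext fun v x => by
        refine Prod.ext rfl (funext fun p => ?_)
        exact map_zero (dC Y i j) }
  naturality Y Z f := by
    ext n
    exact QRep.hom_ext fun v x => Prod.ext rfl (funext fun p => (map_zero (mC f)).symm)

/-- The comparison map from the resolution. -/
noncomputable def β (hA : δ.A = 0) : δ.Res hP ⟶ 𝟭 _ where
  app Y :=
    { f := fun n => ⟨fun v => LinearMap.fst k _ _, fun v w h x => by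
        obtain ⟨y, c⟩ := x
        change ((δ.raw Y n).φ v w h (y, c)).1 = _
        rw [raw_φ, hA]
        simp
        rfl⟩
      comm' := fun i j hij => QRep.hom_ext fun v x => rfl }
  naturality Y Z f := by
    ext n
    exact QRep.hom_ext fun v x => rfl

lemma α_quasiIso (hJ : δ.J = 0) (Y : CochainComplex (QRep P) ℤ) (v : ι) :
    QuasiIso (((QRep.ev P v).mapHomologicalComplex _).map ((δ.α hP hJ).app Y)) := by
  rw [TD.elem_ev]
  intro i j l hij hjl
  constructor
  · rintro x hx ⟨⟨y, c⟩, h⟩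
    exact ⟨y, congrArg Prod.fst h⟩
  · rintro ⟨y, c⟩ h
    have h1 : RHom.g (Y.d j l) v y = 0 := congrArg Prod.fst h
    have h2 : (fun p => dC Y j l (c p)) = 0 := congrArg Prod.snd h
    refine ⟨y, (0, fun p => (0, (c p).1)), h1, ?_⟩
    refine Prod.ext ?_ (funext fun p => ?_)
    · change y = y + RHom.g (Y.d i j) v 0
      rw [map_zero, add_zero]
    · change c p = 0 + dC Y i j (0, (c p).1)
      have h3 := congrFun h2 p
      rw [dC_rel Y hjl] at h3
      rw [dC_rel Y hij, zero_add]
      exact Prod.ext rfl (congrArg Prod.fst h3)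

lemma β_quasiIso (hA : δ.A = 0) (Y : CochainComplex (QRep P) ℤ) (v : ι) :
    QuasiIso (((QRep.ev P v).mapHomologicalComplex _).map ((δ.β hP hA).app Y)) := by
  rw [TD.elem_ev]
  intro i j l hij hjl
  constructor
  · rintro ⟨y, c⟩ h ⟨z, hz⟩
    have h2 : (fun p => dC Y j l (c p)) = 0 := congrArg Prod.snd h
    refine ⟨(z, fun p => (0, (c p).1)), Prod.ext hz (funext fun p => ?_)⟩
    change dC Y i j (0, (c p).1) = c p
    have h3 := congrFun h2 p
    rw [dC_rel Y hjl] at h3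
    rw [dC_rel Y hij]
    exact Prod.ext rfl (congrArg Prod.fst h3).symm
  · intro (y : (Y.X j).raw.V v) h
    refine ⟨(y, 0), 0, Prod.ext h (funext fun p => ?_), ?_⟩
    · exact map_zero (dC Y j l)
    · change y = y + RHom.g (Y.d i j) v 0
      rw [map_zero, add_zero]

end RD
end ResPart

section SidePart

open CategoryTheory Limits

/-- One side of the comparison. -/
structure Side (k : Type) [Field k] (Q : PreQuiver) (R : Set (List Q.A)) (E : Type 1)
    [Category.{0} E] [Preadditive E] (ι : Type) (M : ι → ι → Prop) (P : Raw k ι M → Prop) where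
  D : TD k Q R ι M P
  δ : RD k ι
  hP : ∀ (Y : CochainComplex (QRep P) ℤ) (n : ℤ), P (δ.raw Y n)
  r : E ⥤ QRep P
  add : r.Additive
  full : r.Full
  faithful : r.Faithful
  ess : ∀ (Y : CochainComplex (QRep P) ℤ) (n : ℤ), r.essImage ⟨δ.raw Y n, hP Y n⟩
  JA : δ.J = 0 ∨ δ.A = 0

attribute [instance] Side.add Side.full Side.faithful

variable {k : Type} [Field k] {E : Type 1} [Category.{0} E] [Preadditive E]

lemma Side.W_iff {Q : PreQuiver} {R : Set (List Q.A)} {ι : Type} {M : ι → ι → Prop}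
    {P : Raw k ι M → Prop} (s : Side k Q R E ι M P) {K L : CochainComplex E ℤ} (f : K ⟶ L) :
    ((HomologicalComplex.quasiIso (ModuleCat.{0} (PathAlgebraRel k Q R)ᵐᵒᵖ)
      (ComplexShape.up ℤ)).inverseImage ((s.r ⋙ s.D.tot).mapHomologicalComplex _)) f ↔
    ∀ v, QuasiIso (((s.r ⋙ QRep.ev P v).mapHomologicalComplex _).map f) :=
  s.D.quasiIso_tot ((s.r.mapHomologicalComplex _).map f)

lemma Side.loc {Q : PreQuiver} {R : Set (List Q.A)} {ι : Type} {M : ι → ι → Prop}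
    {P : Raw k ι M → Prop} (s : Side k Q R E ι M P) :
    ((s.r ⋙ s.D.tot).mapHomologicalComplex (ComplexShape.up ℤ) ⋙ DerivedCategory.Q).IsLocalization
      ((HomologicalComplex.quasiIso _ (ComplexShape.up ℤ)).inverseImage
        ((s.r ⋙ s.D.tot).mapHomologicalComplex (ComplexShape.up ℤ))) ∧
    ((s.r ⋙ s.D.tot).mapHomologicalComplex (ComplexShape.up ℤ) ⋙
      DerivedCategory.Q).mapArrow.EssSurj :=
  loc_combined s.r s.D.tot (s.δ.Res s.hP) s.ess (by
    rcases s.JA with h | h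
    · exact Or.inl ⟨s.δ.α s.hP h, fun Y => (s.D.quasiIso_tot _).2 (s.δ.α_quasiIso s.hP h Y)⟩
    · exact Or.inr ⟨s.δ.β s.hP h, fun Y => (s.D.quasiIso_tot _).2 (s.δ.β_quasiIso s.hP h Y)⟩)

theorem Side.equiv [HasZeroObject E] [HasBinaryBiproducts E]
    {Q₁ : PreQuiver} {R₁ : Set (List Q₁.A)} {ι₁ : Type} {M₁ : ι₁ → ι₁ → Prop}
    {P₁ : Raw k ι₁ M₁ → Prop} (s₁ : Side k Q₁ R₁ E ι₁ M₁ P₁)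
    {Q₂ : PreQuiver} {R₂ : Set (List Q₂.A)} {ι₂ : Type} {M₂ : ι₂ → ι₂ → Prop}
    {P₂ : Raw k ι₂ M₂ → Prop} (s₂ : Side k Q₂ R₂ E ι₂ M₂ P₂)
    (h : ∀ {K L : CochainComplex E ℤ} (f : K ⟶ L),
      (∀ v, QuasiIso (((s₁.r ⋙ QRep.ev P₁ v).mapHomologicalComplex _).map f)) ↔
      (∀ v, QuasiIso (((s₂.r ⋙ QRep.ev P₂ v).mapHomologicalComplex _).map f))) :
    DerivedEquivalent k (PathAlgebraRel k Q₁ R₁) (PathAlgebraRel k Q₂ R₂) := by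
  have hWW : ((HomologicalComplex.quasiIso (ModuleCat.{0} (PathAlgebraRel k Q₁ R₁)ᵐᵒᵖ)
      (ComplexShape.up ℤ)).inverseImage ((s₁.r ⋙ s₁.D.tot).mapHomologicalComplex _)) =
    ((HomologicalComplex.quasiIso (ModuleCat.{0} (PathAlgebraRel k Q₂ R₂)ᵐᵒᵖ)
      (ComplexShape.up ℤ)).inverseImage ((s₂.r ⋙ s₂.D.tot).mapHomologicalComplex _)) := by
    ext K L f
    rw [s₁.W_iff, s₂.W_iff, h]
  refine formal_equivalence (s₁.r ⋙ s₁.D.tot) (s₂.r ⋙ s₂.D.tot) _ s₁.loc.1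
    (by rw [hWW]; exact s₂.loc.1) ?_ s₁.loc.2
  rintro K L f ⟨e, rfl⟩
  exact homotopyEquivalences_le_quasiIso _ _ _
    ⟨((s₁.r ⋙ s₁.D.tot).mapHomotopyEquiv e), rfl⟩

theorem DerivedEquivalent.trans {A B C : Type} [Ring A] [Algebra k A] [Ring B] [Algebra k B]
    [Ring C] [Algebra k C] (h₁ : DerivedEquivalent k A B) (h₂ : DerivedEquivalent k B C) :
    DerivedEquivalent k A C := by
  obtain ⟨F, c, h, h'⟩ := h₁
  obtain ⟨G, d, g, g'⟩ := h₂
  letI := c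
  letI := d
  exact ⟨F ⋙ G, inferInstance, inferInstance, inferInstance⟩

end SidePart

section HelperPart

open CategoryTheory Limits

variable {k : Type} [Field k]

lemma lift_inj {A B X : Type} [AddCommGroup A] [AddCommGroup B] [AddCommGroup X]
    [Module k A] [Module k B] [Module k X] (i : A →ₗ[k] B) (hi : Function.Injective i)
    (f : X →ₗ[k] B) (h : ∀ x, ∃ a, i a = f x) : ∃ g : X →ₗ[k] A, ∀ x, i (g x) = f x := by
  choose g hg using h
  exact ⟨{ toFun := g
           map_add' := fun x y => hi (by simp only [map_add, hg])
           map_smul' := fun c x => hi (by simp only [map_smul, hg, RingHom.id_apply]) }, hg⟩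

lemma desc_surj {B C X : Type} [AddCommGroup C] [AddCommGroup B] [AddCommGroup X]
    [Module k C] [Module k B] [Module k X] (p : B →ₗ[k] C) (hp : Function.Surjective p)
    (f : B →ₗ[k] X) (h : ∀ b, p b = 0 → f b = 0) : ∃ g : C →ₗ[k] X, ∀ b, g (p b) = f b := by
  have h' : ∀ b b', p b = p b' → f b = f b' := fun b b' e => by
    have := h (b - b') (by rw [map_sub, e, sub_self])
    rwa [map_sub, sub_eq_zero] at this
  choose s hs using hp
  refine ⟨{ toFun := fun c => f (s c)
            map_add' := fun x y => ?_
            map_smul' := fun c x => ?_ }, fun b => h' _ _ (hs _)⟩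
  · rw [← map_add]; exact h' _ _ (by rw [map_add, hs, hs, hs])
  · rw [RingHom.id_apply, ← map_smul]; exact h' _ _ (by rw [map_smul, hs, hs])

open HomologicalComplex HomologySequence ComposableArrows Abelian in
lemma qi_one {C : Type 1} [Category.{0} C] [Abelian C] {S₁ S₂ : ShortComplex (CochainComplex C ℤ)}
    (φ : S₁ ⟶ S₂) (hS₁ : S₁.ShortExact) (hS₂ : S₂.ShortExact)
    (h₂ : QuasiIso φ.τ₂) (h₃ : QuasiIso φ.τ₃) : QuasiIso φ.τ₁ := by
  rw [quasiIso_iff]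
  intro j
  rw [quasiIsoAt_iff_isIso_homologyMap]
  have hij : (ComplexShape.up ℤ).Rel (j - 1) j := by simp
  apply isIso_of_epi_of_isIso_of_isIso_of_mono (composableArrows₅_exact hS₁ _ j hij).δ₀
    (composableArrows₅_exact hS₂ _ j hij).δ₀
    (δ₀Functor.map (mapComposableArrows₅ φ hS₁ hS₂ (j - 1) j hij))
  · exact inferInstanceAs (Epi (homologyMap φ.τ₂ (j - 1)))
  · exact inferInstanceAs (IsIso (homologyMap φ.τ₃ (j - 1)))
  · exact inferInstanceAs (IsIso (homologyMap φ.τ₂ j))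
  · exact inferInstanceAs (Mono (homologyMap φ.τ₃ j))

open HomologicalComplex HomologySequence ComposableArrows Abelian in
lemma qi_two {C : Type 1} [Category.{0} C] [Abelian C] {S₁ S₂ : ShortComplex (CochainComplex C ℤ)}
    (φ : S₁ ⟶ S₂) (hS₁ : S₁.ShortExact) (hS₂ : S₂.ShortExact)
    (h₁ : QuasiIso φ.τ₁) (h₃ : QuasiIso φ.τ₃) : QuasiIso φ.τ₂ := by
  rw [quasiIso_iff]
  intro j
  rw [quasiIsoAt_iff_isIso_homologyMap]
  have hij : (ComplexShape.up ℤ).Rel (j - 1) j := by simp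
  have hjl : (ComplexShape.up ℤ).Rel j (j + 1) := by simp
  have hm : Mono (homologyMap φ.τ₂ j) := by
    apply mono_of_epi_of_mono_of_mono
      ((δ₀Functor ⋙ δ₀Functor).map (mapComposableArrows₅ φ hS₁ hS₂ (j - 1) j hij))
    · exact (composableArrows₅_exact hS₁ _ j hij).δ₀.δ₀
    · exact (composableArrows₅_exact hS₂ _ j hij).δ₀.δ₀
    · exact inferInstanceAs (Epi (homologyMap φ.τ₃ (j - 1)))
    · exact inferInstanceAs (Mono (homologyMap φ.τ₁ j))
    · exact inferInstanceAs (Mono (homologyMap φ.τ₃ j))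
  have he : Epi (homologyMap φ.τ₂ j) := by
    apply epi_of_epi_of_epi_of_mono
      ((δlastFunctor ⋙ δlastFunctor).map (mapComposableArrows₅ φ hS₁ hS₂ j (j + 1) hjl))
    · exact (composableArrows₅_exact hS₁ j _ hjl).δlast.δlast
    · exact (composableArrows₅_exact hS₂ j _ hjl).δlast.δlast
    · exact inferInstanceAs (Epi (homologyMap φ.τ₁ j))
    · exact inferInstanceAs (Epi (homologyMap φ.τ₃ j))
    · exact inferInstanceAs (Mono (homologyMap φ.τ₁ (j + 1)))
  apply isIso_of_mono_of_epi

/-- Two out of three in short exact sequences. -/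
lemma ses_two {E : Type 1} [Category.{0} E] [Preadditive E] {F₁ F₂ F₃ : E ⥤ ModuleCat.{0} k}
    [F₁.Additive] [F₂.Additive] [F₃.Additive] (i : F₁ ⟶ F₂) (p : F₂ ⟶ F₃)
    (hi : ∀ X, Function.Injective (i.app X)) (hp : ∀ X, Function.Surjective (p.app X))
    (hex : ∀ X y, p.app X y = 0 ↔ ∃ x, i.app X x = y)
    {K L : CochainComplex E ℤ} (f : K ⟶ L) :
    (QuasiIso ((F₁.mapHomologicalComplex _).map f) → QuasiIso ((F₂.mapHomologicalComplex _).map f) →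
      QuasiIso ((F₃.mapHomologicalComplex _).map f)) ∧
    (QuasiIso ((F₁.mapHomologicalComplex _).map f) → QuasiIso ((F₃.mapHomologicalComplex _).map f) →
      QuasiIso ((F₂.mapHomologicalComplex _).map f)) ∧
    (QuasiIso ((F₂.mapHomologicalComplex _).map f) → QuasiIso ((F₃.mapHomologicalComplex _).map f) →
      QuasiIso ((F₁.mapHomologicalComplex _).map f)) := by
  have hz : ∀ X, i.app X ≫ p.app X = 0 := fun X => by
    ext x
    exact (hex X _).2 ⟨x, rfl⟩
  have hs : ∀ X, (ShortComplex.mk _ _ (hz X)).ShortExact := fun X => by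
    haveI : Mono (i.app X) := (ModuleCat.mono_iff_injective _).2 (hi X)
    haveI : Epi (p.app X) := (ModuleCat.epi_iff_surjective _).2 (hp X)
    exact ⟨(ShortComplex.moduleCat_exact_iff _).2 fun y hy => (hex X y).1 hy⟩
  let S : CochainComplex E ℤ → ShortComplex (CochainComplex (ModuleCat.{0} k) ℤ) := fun K =>
    ShortComplex.mk ((NatTrans.mapHomologicalComplex i (ComplexShape.up ℤ)).app K)
      ((NatTrans.mapHomologicalComplex p (ComplexShape.up ℤ)).app K) (by
        ext n : 1
        exact hz _)
  have hS : ∀ K, (S K).ShortExact := fun K =>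
    HomologicalComplex.shortExact_of_degreewise_shortExact _ fun n => hs (K.X n)
  let φ : S K ⟶ S L :=
    { τ₁ := (F₁.mapHomologicalComplex _).map f
      τ₂ := (F₂.mapHomologicalComplex _).map f
      τ₃ := (F₃.mapHomologicalComplex _).map f
      comm₁₂ := (NatTrans.mapHomologicalComplex i (ComplexShape.up ℤ)).naturality f
      comm₂₃ := (NatTrans.mapHomologicalComplex p (ComplexShape.up ℤ)).naturality f }
  exact ⟨fun h1 h2 => HomologicalComplex.HomologySequence.quasiIso_τ₃ φ (hS K) (hS L) h1 h2,
    fun h1 h3 => qi_two φ (hS K) (hS L) h1 h3,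
    fun h2 h3 => qi_one φ (hS K) (hS L) h2 h3⟩

variable {ι : Type} {M : ι → ι → Prop} {P : Raw k ι M → Prop}

/-- The natural transformation given by an arrow. -/
def QRep.evφ (P : Raw k ι M → Prop) (v w : ι) (h : M v w) : QRep.ev P v ⟶ QRep.ev P w where
  app X := ModuleCat.ofHom (X.raw.φ v w h)
  naturality X Y f := by
    ext x
    exact (f.comm v w h x).symm

lemma QRep.ses (u v w : ι) (h : M u v) (h' : M v w)
    (hi : ∀ X, P X → Function.Injective (X.φ u v h))
    (hp : ∀ X, P X → Function.Surjective (X.φ v w h'))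
    (hex : ∀ X, P X → ∀ y, X.φ v w h' y = 0 ↔ ∃ x, X.φ u v h x = y)
    {K L : CochainComplex (QRep P) ℤ} (f : K ⟶ L) :
    let q := fun t => QuasiIso (((QRep.ev P t).mapHomologicalComplex (ComplexShape.up ℤ)).map f)
    (q u → q v → q w) ∧ (q u → q w → q v) ∧ (q v → q w → q u) :=
  ses_two (QRep.evφ P u v h) (QRep.evφ P v w h') (fun X => hi X.raw X.prop)
    (fun X => hp X.raw X.prop) (fun X => hex X.raw X.prop) f

variable {ι' : Type} {M' : ι' → ι' → Prop} {P' : Raw k ι' M' → Prop}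

/-- Restriction of a raw representation. -/
def Raw.restr (X : Raw k ι' M') (τ : ι → ι') (hτ : ∀ v w, M v w → M' (τ v) (τ w)) :
    Raw k ι M where
  V v := X.V (τ v)
  φ v w h := X.φ (τ v) (τ w) (hτ v w h)

/-- Restriction of representations. -/
def QRep.restr (τ : ι → ι') (hτ : ∀ v w, M v w → M' (τ v) (τ w))
    (hP : ∀ X : Raw k ι' M', P' X → P (X.restr τ hτ)) : QRep P' ⥤ QRep P where
  obj X := ⟨X.raw.restr τ hτ, hP _ X.prop⟩
  map f := ⟨fun v => f.g (τ v), fun v w h x => f.comm _ _ _ x⟩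

instance (τ : ι → ι') (hτ : ∀ v w, M v w → M' (τ v) (τ w))
    (hP : ∀ X : Raw k ι' M', P' X → P (X.restr τ hτ)) :
    (QRep.restr τ hτ hP).Additive where
  map_add := rfl

lemma QRep.restr_ev (τ : ι → ι') (hτ : ∀ v w, M v w → M' (τ v) (τ w))
    (hP : ∀ X : Raw k ι' M', P' X → P (X.restr τ hτ)) (v : ι)
    {K L : CochainComplex (QRep P') ℤ} (f : K ⟶ L) :
    QuasiIso (((QRep.restr τ hτ hP ⋙ QRep.ev P v).mapHomologicalComplex _).map f) ↔
    QuasiIso (((QRep.ev P' (τ v)).mapHomologicalComplex _).map f) := Iff.rfl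

lemma QRep.essImage_of {C : Type 1} [Category.{0} C] (F : C ⥤ QRep P) (X : C) (Y : QRep P)
    (e : ∀ v, (F.obj X).raw.V v ≃ₗ[k] Y.raw.V v)
    (he : ∀ v w h x, e w ((F.obj X).raw.φ v w h x) = Y.raw.φ v w h (e v x)) :
    F.essImage Y :=
  ⟨X, ⟨{ hom := ⟨fun v => (e v).toLinearMap, he⟩
         inv := ⟨fun v => (e v).symm.toLinearMap, fun v w h x => by
            apply (e w).injective
            simp [he]⟩
         hom_inv_id := QRep.hom_ext fun v x => (e v).symm_apply_apply x
         inv_hom_id := QRep.hom_ext fun v x => (e v).apply_symm_apply x }⟩⟩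

end HelperPart

section FlipPart

open CategoryTheory Limits

/-- The vertices of the star. -/
inductive VD | c | l1 | l2 | x

/-- The vertices of the enlarged star. -/
inductive VE | c | l1 | l2 | v | w

/-- The arrows of the star with given orientations. -/
def MD (e1 e2 e3 : Prop) : VD → VD → Prop
  | .c, .l1 => e1
  | .l1, .c => ¬ e1
  | .c, .l2 => e2
  | .l2, .c => ¬ e2
  | .c, .x => e3
  | .x, .c => ¬ e3
  | _, _ => False

/-- The arrows of the enlarged star. -/
def ME (e1 e2 : Prop) : VE → VE → Prop
  | .c, .l1 => e1
  | .l1, .c => ¬ e1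
  | .c, .l2 => e2
  | .l2, .c => ¬ e2
  | .c, .v => True
  | .w, .c => True
  | _, _ => False

variable {k : Type} [Field k] {e1 e2 : Prop}

/-- The condition of being a short exact sequence. -/
structure PE (X : Raw k VE (ME e1 e2)) : Prop where
  inj : Function.Injective (X.φ .w .c trivial)
  surj : Function.Surjective (X.φ .c .v trivial)
  ex : ∀ y, X.φ .c .v trivial y = 0 ↔ ∃ x, X.φ .w .c trivial x = y

instance : PClosed (PE (k := k) (e1 := e1) (e2 := e2)) where
  zero := ⟨fun _ _ _ => rfl, fun y => ⟨y, rfl⟩, fun y => ⟨fun _ => ⟨y, rfl⟩, fun _ => rfl⟩⟩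
  prod X Y hX hY := by
    refine ⟨fun a b h => ?_, fun y => ?_, fun y => ?_⟩
    · exact Prod.ext (hX.inj (congrArg Prod.fst h)) (hY.inj (congrArg Prod.snd h))
    · obtain ⟨a, ha⟩ := hX.surj y.1
      obtain ⟨b, hb⟩ := hY.surj y.2
      exact ⟨(a, b), Prod.ext ha hb⟩
    · constructor
      · intro h
        obtain ⟨a, ha⟩ := (hX.ex y.1).1 (congrArg Prod.fst h)
        obtain ⟨b, hb⟩ := (hY.ex y.2).1 (congrArg Prod.snd h)
        exact ⟨(a, b), Prod.ext ha hb⟩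
      · rintro ⟨a, ha⟩
        exact Prod.ext ((hX.ex y.1).2 ⟨a.1, congrArg Prod.fst ha⟩)
          ((hY.ex y.2).2 ⟨a.2, congrArg Prod.snd ha⟩)

/-- The vertices for the left side. -/
def tauL : VD → VE
  | .c => .c
  | .l1 => .l1
  | .l2 => .l2
  | .x => .v

/-- The vertices for the right side. -/
def tauR : VD → VE
  | .c => .c
  | .l1 => .l1
  | .l2 => .l2
  | .x => .w

lemma tauL_M : ∀ u u', MD e1 e2 True u u' → ME e1 e2 (tauL u) (tauL u') := by
  intro u u' h
  cases u <;> cases u' <;> first | exact h | exact (h trivial).elim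

lemma tauR_M : ∀ u u', MD e1 e2 False u u' → ME e1 e2 (tauR u) (tauR u') := by
  intro u u' h
  cases u <;> cases u' <;> first | exact h | exact trivial | exact h.elim

/-- The restriction functor for the left side. -/
def flipL (k : Type) [Field k] (e1 e2 : Prop) : QRep (PE (k := k) (e1 := e1) (e2 := e2)) ⥤
    QRep (fun _ : Raw k VD (MD e1 e2 True) => True) :=
  QRep.restr tauL tauL_M (fun _ _ => trivial)

/-- The restriction functor for the right side. -/
def flipR (k : Type) [Field k] (e1 e2 : Prop) : QRep (PE (k := k) (e1 := e1) (e2 := e2)) ⥤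
    QRep (fun _ : Raw k VD (MD e1 e2 False) => True) :=
  QRep.restr tauR tauR_M (fun _ _ => trivial)

instance : (flipL k e1 e2).Additive := by unfold flipL; infer_instance
instance : (flipR k e1 e2).Additive := by unfold flipR; infer_instance

instance : (flipL k e1 e2).Faithful where
  map_injective {X Y} f g h := by
    have hh : ∀ u x, RHom.g f (tauL u) x = RHom.g g (tauL u) x := fun u x =>
      congrArg (fun t : (flipL k e1 e2).obj X ⟶ (flipL k e1 e2).obj Y => RHom.g t u x) h
    refine QRep.hom_ext fun v x => ?_
    cases v with
    | c => exact hh .c x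
    | l1 => exact hh .l1 x
    | l2 => exact hh .l2 x
    | v => exact hh .x x
    | w =>
      apply Y.prop.inj
      exact ((RHom.comm f .w .c trivial x).symm.trans (hh .c _)).trans (RHom.comm g .w .c trivial x)

instance : (flipL k e1 e2).Full where
  map_surjective {X Y} h := by
    have hc : ∀ v w m x, RHom.g h w (X.raw.φ (tauL v) (tauL w) (tauL_M v w m) x) =
      Y.raw.φ (tauL v) (tauL w) (tauL_M v w m) (RHom.g h v x) := RHom.comm h
    obtain ⟨g, hg⟩ := lift_inj (Y.raw.φ .w .c trivial) Y.prop.inj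
      ((RHom.g h .c).comp (X.raw.φ .w .c trivial)) (fun x => by
        rw [← Y.prop.ex]
        refine (hc .c .x trivial _).symm.trans ?_
        change RHom.g h .x (X.raw.φ .c .v trivial (X.raw.φ .w .c trivial x)) = 0
        rw [(X.prop.ex _).2 ⟨x, rfl⟩]
        exact map_zero (RHom.g h .x))
    let G : ∀ u, X.raw.V u →ₗ[k] Y.raw.V u := fun u => match u with
      | .c => RHom.g h .c
      | .l1 => RHom.g h .l1
      | .l2 => RHom.g h .l2
      | .v => RHom.g h .x
      | .w => g
    refine ⟨⟨G, ?_⟩, ?_⟩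
    · intro v w m x
      cases v <;> cases w <;> first
        | exact (m : False).elim
        | exact hc .c .l1 m x
        | exact hc .l1 .c m x
        | exact hc .c .l2 m x
        | exact hc .l2 .c m x
        | exact hc .c .x m x
        | exact (hg x).symm
    · refine QRep.hom_ext fun v x => ?_
      cases v <;> rfl

instance : (flipR k e1 e2).Faithful where
  map_injective {X Y} f g h := by
    have hh : ∀ u x, RHom.g f (tauR u) x = RHom.g g (tauR u) x := fun u x =>
      congrArg (fun t : (flipR k e1 e2).obj X ⟶ (flipR k e1 e2).obj Y => RHom.g t u x) h
    refine QRep.hom_ext fun v x => ?_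
    cases v with
    | c => exact hh .c x
    | l1 => exact hh .l1 x
    | l2 => exact hh .l2 x
    | w => exact hh .x x
    | v =>
      obtain ⟨x, rfl⟩ := X.prop.surj x
      exact ((RHom.comm f .c .v trivial x).trans
        (congrArg (Y.raw.φ .c .v trivial) (hh .c x))).trans (RHom.comm g .c .v trivial x).symm

instance : (flipR k e1 e2).Full where
  map_surjective {X Y} h := by
    have hc : ∀ v w m x, RHom.g h w (X.raw.φ (tauR v) (tauR w) (tauR_M v w m) x) =
      Y.raw.φ (tauR v) (tauR w) (tauR_M v w m) (RHom.g h v x) := RHom.comm h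
    obtain ⟨g, hg⟩ := desc_surj (X.raw.φ .c .v trivial) X.prop.surj
      ((Y.raw.φ .c .v trivial).comp (RHom.g h .c)) (fun x hx => by
        obtain ⟨z, rfl⟩ := (X.prop.ex x).1 hx
        exact (Y.prop.ex _).2 ⟨RHom.g h .x z, (hc .x .c id z).symm⟩)
    let G : ∀ u, X.raw.V u →ₗ[k] Y.raw.V u := fun u => match u with
      | .c => RHom.g h .c
      | .l1 => RHom.g h .l1
      | .l2 => RHom.g h .l2
      | .w => RHom.g h .x
      | .v => g
    refine ⟨⟨G, ?_⟩, ?_⟩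
    · intro v w m x
      cases v <;> cases w <;> first
        | exact (m : False).elim
        | exact hc .c .l1 m x
        | exact hc .l1 .c m x
        | exact hc .c .l2 m x
        | exact hc .l2 .c m x
        | exact hc .x .c id x
        | exact hg x
    · refine QRep.hom_ext fun v x => ?_
      cases v <;> rfl

/-- Extension by the kernel. -/
def extL (Z : Raw k VD (MD e1 e2 True)) : Raw k VE (ME e1 e2) where
  V u := match u with
    | .c => Z.V .c
    | .l1 => Z.V .l1
    | .l2 => Z.V .l2
    | .v => Z.V .x
    | .w => ModuleCat.of k (LinearMap.ker (Z.φ .c .x trivial))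
  φ u u' m := match u, u', m with
    | .c, .l1, m => Z.φ .c .l1 m
    | .l1, .c, m => Z.φ .l1 .c m
    | .c, .l2, m => Z.φ .c .l2 m
    | .l2, .c, m => Z.φ .l2 .c m
    | .c, .v, _ => Z.φ .c .x trivial
    | .w, .c, _ => (LinearMap.ker (Z.φ .c .x trivial)).subtype
    | _, _, _ => 0

/-- Extension by the cokernel. -/
def extR (Z : Raw k VD (MD e1 e2 False)) : Raw k VE (ME e1 e2) where
  V u := match u with
    | .c => Z.V .c
    | .l1 => Z.V .l1
    | .l2 => Z.V .l2
    | .w => Z.V .x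
    | .v => ModuleCat.of k (Z.V .c ⧸ LinearMap.range (Z.φ .x .c id))
  φ u u' m := match u, u', m with
    | .c, .l1, m => Z.φ .c .l1 m
    | .l1, .c, m => Z.φ .l1 .c m
    | .c, .l2, m => Z.φ .c .l2 m
    | .l2, .c, m => Z.φ .l2 .c m
    | .w, .c, _ => Z.φ .x .c id
    | .c, .v, _ => (LinearMap.range (Z.φ .x .c id)).mkQ
    | _, _, _ => 0

lemma flipL_ess (Z : QRep (fun _ : Raw k VD (MD e1 e2 True) => True))
    (hZ : Function.Surjective (Z.raw.φ .c .x trivial)) : (flipL k e1 e2).essImage Z := by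
  refine QRep.essImage_of _ ⟨extL Z.raw, ⟨?_, hZ, ?_⟩⟩ _
    (fun u => match u with
      | .c => LinearEquiv.refl k _
      | .l1 => LinearEquiv.refl k _
      | .l2 => LinearEquiv.refl k _
      | .x => LinearEquiv.refl k _) ?_
  · exact Subtype.val_injective
  · intro y
    exact ⟨fun h => ⟨⟨y, h⟩, rfl⟩, fun ⟨x, hx⟩ => hx ▸ x.2⟩
  · intro v w m x
    cases v <;> cases w <;> first | rfl | exact (m : False).elim | exact (m trivial).elim

lemma flipR_ess (Z : QRep (fun _ : Raw k VD (MD e1 e2 False) => True))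
    (hZ : Function.Injective (Z.raw.φ .x .c id)) : (flipR k e1 e2).essImage Z := by
  refine QRep.essImage_of _ ⟨extR Z.raw, ⟨hZ, ?_, ?_⟩⟩ _
    (fun u => match u with
      | .c => LinearEquiv.refl k _
      | .l1 => LinearEquiv.refl k _
      | .l2 => LinearEquiv.refl k _
      | .x => LinearEquiv.refl k _) ?_
  · exact Submodule.mkQ_surjective _
  · intro y
    exact Submodule.Quotient.mk_eq_zero (LinearMap.range (Z.raw.φ .x .c id))
  · intro v w m x
    cases v <;> cases w <;> first | rfl | exact (m : False).elim

/-- The resolution datum on the left. -/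
def dL (k : Type) [Field k] : RD k VD where
  S u := u = .c
  A u u' := match u, u' with
    | .c, .x => 1
    | _, _ => 0
  B := 0
  J := 0

/-- The resolution datum on the right. -/
def dR (k : Type) [Field k] : RD k VD where
  S u := u = .c
  A := 0
  B := 0
  J u u' := match u, u' with
    | .x, .c => 1
    | _, _ => 0

variable {Q₁ : PreQuiver} {R₁ : Set (List Q₁.A)} {Q₂ : PreQuiver} {R₂ : Set (List Q₂.A)}

/-- The left side. -/
def sideL (D : TD k Q₁ R₁ VD (MD e1 e2 True) (fun _ => True)) :
    Side k Q₁ R₁ (QRep (PE (k := k) (e1 := e1) (e2 := e2))) VD (MD e1 e2 True) (fun _ => True) where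
  D := D
  δ := dL k
  hP _ _ := trivial
  r := flipL k e1 e2
  add := inferInstance
  full := inferInstance
  faithful := inferInstance
  ess Y n := by
    apply flipL_ess
    rintro ⟨y, c⟩
    obtain ⟨c', hc⟩ := RD.pr_surj Y n VD.x y
    refine ⟨(0, (dL k).ee Y VD.c c'), ?_⟩
    refine ((dL k).raw_φ Y n VD.c VD.x trivial 0 _).trans (Prod.ext ?_ (funext fun p => ?_))
    · rw [RD.rr_ee _ _ _ rfl, hc, map_zero, zero_add]
      exact one_smul k y
    · exact VD.noConfusion p.down
  JA := Or.inl rfl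

/-- The right side. -/
def sideR (D : TD k Q₂ R₂ VD (MD e1 e2 False) (fun _ => True)) :
    Side k Q₂ R₂ (QRep (PE (k := k) (e1 := e1) (e2 := e2))) VD (MD e1 e2 False) (fun _ => True) where
  D := D
  δ := dR k
  hP _ _ := trivial
  r := flipR k e1 e2
  add := inferInstance
  full := inferInstance
  faithful := inferInstance
  ess Y n := by
    apply flipR_ess
    rw [injective_iff_map_eq_zero]
    rintro ⟨y, c⟩ h
    have h1 := ((dR k).raw_φ Y n VD.x VD.c id y c).symm.trans h
    have h2 := congrFun (congrArg Prod.snd h1) ⟨rfl⟩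
    change (0 : k) • (dR k).rr Y VD.x c + (1 : k) • RD.jn Y n VD.x y = 0 at h2
    rw [zero_smul, zero_add, one_smul] at h2
    refine Prod.ext (RD.jn_inj Y n VD.x y h2) (funext fun p => ?_)
    exact VD.noConfusion p.down
  JA := Or.inr rfl

lemma flip_W {K L : CochainComplex (QRep (PE (k := k) (e1 := e1) (e2 := e2))) ℤ} (f : K ⟶ L) :
    (∀ v, QuasiIso (((flipL k e1 e2 ⋙ QRep.ev _ v).mapHomologicalComplex _).map f)) ↔
    (∀ v, QuasiIso (((flipR k e1 e2 ⋙ QRep.ev _ v).mapHomologicalComplex _).map f)) := by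
  have hs := QRep.ses (P := PE (k := k) (e1 := e1) (e2 := e2)) VE.w VE.c VE.v trivial trivial
    (fun X h => h.inj) (fun X h => h.surj) (fun X h => h.ex) f
  constructor
  · intro h u
    cases u with
    | c => exact h .c
    | l1 => exact h .l1
    | l2 => exact h .l2
    | x => exact hs.2.2 (h .c) (h .x)
  · intro h u
    cases u with
    | c => exact h .c
    | l1 => exact h .l1
    | l2 => exact h .l2
    | x => exact hs.1 (h .x) (h .c)

theorem flip_LR (D₁ : TD k Q₁ R₁ VD (MD e1 e2 True) (fun _ => True))
    (D₂ : TD k Q₂ R₂ VD (MD e1 e2 False) (fun _ => True)) :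
    DerivedEquivalent k (PathAlgebraRel k Q₁ R₁) (PathAlgebraRel k Q₂ R₂) :=
  Side.equiv (sideL D₁) (sideR D₂) (fun f => flip_W f)

theorem flip_RL (D₁ : TD k Q₁ R₁ VD (MD e1 e2 True) (fun _ => True))
    (D₂ : TD k Q₂ R₂ VD (MD e1 e2 False) (fun _ => True)) :
    DerivedEquivalent k (PathAlgebraRel k Q₂ R₂) (PathAlgebraRel k Q₁ R₁) :=
  Side.equiv (sideR D₂) (sideL D₁) (fun f => (flip_W f).symm)

end FlipPart

section NakPart

open CategoryTheory Limits

/-- The vertices of the linear quiver. -/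
inductive VN | y1 | y2 | y3 | y4

/-- The vertices of the common enlargement. -/
inductive VX | x1 | f | x2 | g | x3 | x4

/-- The arrows of the linear quiver. -/
abbrev MN : VN → VN → Prop
  | .y1, .y2 => True
  | .y2, .y3 => True
  | .y3, .y4 => True
  | _, _ => False

/-- The arrows of the common enlargement. -/
abbrev MX : VX → VX → Prop
  | .x1, .f => True
  | .x1, .x2 => True
  | .f, .x2 => True
  | .f, .g => True
  | .x2, .x3 => True
  | .x2, .x4 => True
  | .g, .x3 => True
  | .x3, .x4 => True
  | _, _ => False

variable {k : Type} [Field k]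

/-- The zero relation. -/
def PN (X : Raw k VN MN) : Prop :=
  ∀ x, X.φ .y3 .y4 trivial (X.φ .y2 .y3 trivial (X.φ .y1 .y2 trivial x)) = 0

/-- The conditions on the common enlargement. -/
structure PX (X : Raw k VX MX) : Prop where
  c1 : ∀ x, X.φ .f .x2 trivial (X.φ .x1 .f trivial x) = X.φ .x1 .x2 trivial x
  c2 : ∀ x, X.φ .x3 .x4 trivial (X.φ .x2 .x3 trivial x) = X.φ .x2 .x4 trivial x
  sq : ∀ x, X.φ .x2 .x3 trivial (X.φ .f .x2 trivial x) = X.φ .g .x3 trivial (X.φ .f .g trivial x)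
  ginj : Function.Injective (X.φ .g .x3 trivial)
  gsurj : Function.Surjective (X.φ .x3 .x4 trivial)
  gex : ∀ y, X.φ .x3 .x4 trivial y = 0 ↔ ∃ x, X.φ .g .x3 trivial x = y
  finj : Function.Injective (X.φ .f .x2 trivial)
  fsurj : Function.Surjective (X.φ .x2 .x4 trivial)
  fex : ∀ y, X.φ .x2 .x4 trivial y = 0 ↔ ∃ x, X.φ .f .x2 trivial x = y

lemma prod_ex {A B C A' B' C' : Type} [Zero C] [Zero C'] (i : A → B) (p : B → C) (i' : A' → B')
    (p' : B' → C') (h : ∀ y, p y = 0 ↔ ∃ x, i x = y) (h' : ∀ y, p' y = 0 ↔ ∃ x, i' x = y)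
    (y : B × B') : (p y.1, p' y.2) = 0 ↔ ∃ x : A × A', (i x.1, i' x.2) = y := by
  constructor
  · intro hy
    obtain ⟨a, ha⟩ := (h y.1).1 (congrArg Prod.fst hy)
    obtain ⟨b, hb⟩ := (h' y.2).1 (congrArg Prod.snd hy)
    exact ⟨(a, b), Prod.ext ha hb⟩
  · rintro ⟨a, ha⟩
    exact Prod.ext ((h y.1).2 ⟨a.1, congrArg Prod.fst ha⟩)
      ((h' y.2).2 ⟨a.2, congrArg Prod.snd ha⟩)

lemma prod_inj {A B A' B' : Type} (i : A → B) (i' : A' → B') (h : Function.Injective i)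
    (h' : Function.Injective i') : Function.Injective fun x : A × A' => (i x.1, i' x.2) :=
  fun _ _ e => Prod.ext (h (congrArg Prod.fst e)) (h' (congrArg Prod.snd e))

lemma prod_surj {A B A' B' : Type} (i : A → B) (i' : A' → B') (h : Function.Surjective i)
    (h' : Function.Surjective i') : Function.Surjective fun x : A × A' => (i x.1, i' x.2) :=
  fun y => by
    obtain ⟨a, ha⟩ := h y.1
    obtain ⟨b, hb⟩ := h' y.2
    exact ⟨(a, b), Prod.ext ha hb⟩

instance : PClosed (PX (k := k)) where
  zero :=
    { c1 := fun _ => rfl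
      c2 := fun _ => rfl
      sq := fun _ => rfl
      ginj := fun _ _ _ => rfl
      gsurj := fun y => ⟨y, rfl⟩
      gex := fun y => ⟨fun _ => ⟨y, rfl⟩, fun _ => rfl⟩
      finj := fun _ _ _ => rfl
      fsurj := fun y => ⟨y, rfl⟩
      fex := fun y => ⟨fun _ => ⟨y, rfl⟩, fun _ => rfl⟩ }
  prod X Y hX hY :=
    { c1 := fun x => Prod.ext (hX.c1 x.1) (hY.c1 x.2)
      c2 := fun x => Prod.ext (hX.c2 x.1) (hY.c2 x.2)
      sq := fun x => Prod.ext (hX.sq x.1) (hY.sq x.2)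
      ginj := prod_inj _ _ hX.ginj hY.ginj
      gsurj := prod_surj _ _ hX.gsurj hY.gsurj
      gex := prod_ex _ _ _ _ hX.gex hY.gex
      finj := prod_inj _ _ hX.finj hY.finj
      fsurj := prod_surj _ _ hX.fsurj hY.fsurj
      fex := prod_ex _ _ _ _ hX.fex hY.fex }

/-- The vertices of the linear quiver in the enlargement. -/
def tauN : VN → VX
  | .y1 => .x1
  | .y2 => .x2
  | .y3 => .x3
  | .y4 => .x4

/-- The vertices of the star in the enlargement. -/
def tauS : VD → VX
  | .c => .f
  | .l1 => .x1
  | .l2 => .x2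
  | .x => .g

lemma tauN_M : ∀ u u', MN u u' → MX (tauN u) (tauN u') := by
  intro u u' h
  cases u <;> cases u' <;> first | exact h | exact h.elim

lemma resN_P (X : Raw k VX MX) (h : PX X) : PN (X.restr tauN tauN_M) := fun x =>
  (h.c2 (X.φ .x1 .x2 trivial x)).trans ((h.fex _).2 ⟨_, h.c1 x⟩)

lemma tauS_M : ∀ u u', MD False True True u u' → MX (tauS u) (tauS u') := by
  intro u u' h
  cases u <;> cases u' <;> first | exact h | exact trivial | exact h.elim | exact (h trivial).elim

/-- Restriction to the linear quiver. -/
def resN (k : Type) [Field k] : QRep (PX (k := k)) ⥤ QRep (PN (k := k)) :=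
  QRep.restr tauN tauN_M resN_P

/-- Restriction to the star. -/
def resS (k : Type) [Field k] : QRep (PX (k := k)) ⥤
    QRep (fun _ : Raw k VD (MD False True True) => True) :=
  QRep.restr tauS tauS_M (fun _ _ => trivial)

instance : (resN k).Additive := by unfold resN; infer_instance
instance : (resS k).Additive := by unfold resS; infer_instance

instance : (resN k).Faithful where
  map_injective {X Y} f g h := by
    have hh : ∀ u x, RHom.g f (tauN u) x = RHom.g g (tauN u) x := fun u x =>
      congrArg (fun t : (resN k).obj X ⟶ (resN k).obj Y => RHom.g t u x) h
    refine QRep.hom_ext fun v x => ?_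
    cases v with
    | x1 => exact hh .y1 x
    | x2 => exact hh .y2 x
    | x3 => exact hh .y3 x
    | x4 => exact hh .y4 x
    | f =>
      apply Y.prop.finj
      exact ((RHom.comm f .f .x2 trivial x).symm.trans (hh .y2 _)).trans
        (RHom.comm g .f .x2 trivial x)
    | g =>
      apply Y.prop.ginj
      exact ((RHom.comm f .g .x3 trivial x).symm.trans (hh .y3 _)).trans
        (RHom.comm g .g .x3 trivial x)

lemma resN_ext (X Y : Raw k VX MX) (hX : PX X) (hY : PX Y) (p1 : X.V .x1 →ₗ[k] Y.V .x1)
    (p2 : X.V .x2 →ₗ[k] Y.V .x2) (p3 : X.V .x3 →ₗ[k] Y.V .x3) (p4 : X.V .x4 →ₗ[k] Y.V .x4)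
    (h12 : ∀ x, p2 (X.φ .x1 .x2 trivial x) = Y.φ .x1 .x2 trivial (p1 x))
    (h23 : ∀ x, p3 (X.φ .x2 .x3 trivial x) = Y.φ .x2 .x3 trivial (p2 x))
    (h34 : ∀ x, p4 (X.φ .x3 .x4 trivial x) = Y.φ .x3 .x4 trivial (p3 x)) :
    ∃ G : RHom X Y, G.g .x1 = p1 ∧ G.g .x2 = p2 ∧ G.g .x3 = p3 ∧ G.g .x4 = p4 := by
  have h24 : ∀ x, p4 (X.φ .x2 .x4 trivial x) =
    Y.φ .x2 .x4 trivial (p2 x) := fun x => by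
      rw [← hX.c2, ← hY.c2, h34, h23]
  obtain ⟨gf, hgf⟩ := lift_inj (Y.φ .f .x2 trivial) hY.finj
    (p2.comp (X.φ .f .x2 trivial)) (fun x => by
      rw [← hY.fex]
      refine (h24 _).symm.trans ?_
      rw [(hX.fex _).2 ⟨x, rfl⟩]
      exact map_zero p4)
  obtain ⟨gg, hgg⟩ := lift_inj (Y.φ .g .x3 trivial) hY.ginj
    (p3.comp (X.φ .g .x3 trivial)) (fun x => by
      rw [← hY.gex]
      refine (h34 _).symm.trans ?_
      rw [(hX.gex _).2 ⟨x, rfl⟩]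
      exact map_zero p4)
  let G : ∀ u, X.V u →ₗ[k] Y.V u := fun u => match u with
    | .x1 => p1
    | .x2 => p2
    | .x3 => p3
    | .x4 => p4
    | .f => gf
    | .g => gg
  have hf : ∀ x, Y.φ .f .x2 trivial (gf x) = p2 (X.φ .f .x2 trivial x) := hgf
  have hg : ∀ x, Y.φ .g .x3 trivial (gg x) = p3 (X.φ .g .x3 trivial x) := hgg
  have h1f : ∀ x, gf (X.φ .x1 .f trivial x) = Y.φ .x1 .f trivial (p1 x) :=
    fun x => by
      apply hY.finj
      rw [hf, hX.c1, hY.c1, h12]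
  have hfg : ∀ x, gg (X.φ .f .g trivial x) = Y.φ .f .g trivial (gf x) :=
    fun x => by
      apply hY.ginj
      rw [hg, ← hX.sq, ← hY.sq, hf, h23]
  refine ⟨⟨G, ?_⟩, rfl, rfl, rfl, rfl⟩
  · intro v w m x
    cases v <;> cases w <;> first
      | exact (m : False).elim
      | exact h12 x
      | exact h23 x
      | exact h34 x
      | exact h24 x
      | exact h1f x
      | exact hfg x
      | exact (hf x).symm
      | exact (hg x).symm

instance : (resN k).Full where
  map_surjective {X Y} h := by
    obtain ⟨G, h1, h2, h3, h4⟩ := resN_ext X.raw Y.raw X.prop Y.prop (RHom.g h .y1) (RHom.g h .y2)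
      (RHom.g h .y3) (RHom.g h .y4) (RHom.comm h .y1 .y2 trivial) (RHom.comm h .y2 .y3 trivial)
      (RHom.comm h .y3 .y4 trivial)
    refine ⟨G, QRep.hom_ext fun v x => ?_⟩
    cases v with
    | y1 => exact LinearMap.congr_fun h1 x
    | y2 => exact LinearMap.congr_fun h2 x
    | y3 => exact LinearMap.congr_fun h3 x
    | y4 => exact LinearMap.congr_fun h4 x

/-- The surjection onto the third vertex. -/
def sum3 (X : Raw k VX MX) : (X.V .x2 × X.V .g) →ₗ[k] X.V .x3 :=
  (X.φ .x2 .x3 trivial).coprod (X.φ .g .x3 trivial)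

lemma sum3_surj (X : Raw k VX MX) (h : PX X) : Function.Surjective (sum3 X) := by
  intro z
  obtain ⟨a, ha⟩ := h.fsurj (X.φ .x3 .x4 trivial z)
  obtain ⟨b, hb⟩ := (h.gex (z - X.φ .x2 .x3 trivial a)).1 (by
    rw [map_sub, h.c2, ha, sub_self])
  refine ⟨(a, b), ?_⟩
  change X.φ .x2 .x3 trivial a + X.φ .g .x3 trivial b = z
  rw [hb, add_sub_cancel]

lemma sum3_ker (X : Raw k VX MX) (h : PX X) (y : X.V .x2 × X.V .g) (hy : sum3 X y = 0) :
    ∃ u, X.φ .f .x2 trivial u = y.1 ∧ - X.φ .f .g trivial u = y.2 := by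
  have hy' : X.φ .x2 .x3 trivial y.1 + X.φ .g .x3 trivial y.2 = 0 := hy
  obtain ⟨u, hu⟩ := (h.fex y.1).1 (by
    rw [← h.c2, eq_neg_of_add_eq_zero_left hy', map_neg, (h.gex _).2 ⟨_, rfl⟩, neg_zero])
  refine ⟨u, hu, h.ginj ?_⟩
  rw [map_neg, ← h.sq, hu, eq_neg_of_add_eq_zero_left hy', neg_neg]

instance : (resS k).Faithful where
  map_injective {X Y} f g h := by
    have hh : ∀ u x, RHom.g f (tauS u) x = RHom.g g (tauS u) x := fun u x =>
      congrArg (fun t : (resS k).obj X ⟶ (resS k).obj Y => RHom.g t u x) h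
    have h2 : ∀ x, RHom.g f .x2 x = RHom.g g .x2 x := hh .l2
    have hg : ∀ x, RHom.g f .g x = RHom.g g .g x := hh .x
    refine QRep.hom_ext fun v x => ?_
    cases v with
    | x1 => exact hh .l1 x
    | x2 => exact hh .l2 x
    | f => exact hh .c x
    | g => exact hh .x x
    | x4 =>
      obtain ⟨x, rfl⟩ := X.prop.fsurj x
      exact ((RHom.comm f .x2 .x4 trivial x).trans
        (congrArg (Y.raw.φ .x2 .x4 trivial) (hh .l2 x))).trans (RHom.comm g .x2 .x4 trivial x).symm
    | x3 =>
      obtain ⟨x, rfl⟩ := sum3_surj _ X.prop x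
      change RHom.g f .x3 (X.raw.φ .x2 .x3 trivial x.1 + X.raw.φ .g .x3 trivial x.2) =
        RHom.g g .x3 (X.raw.φ .x2 .x3 trivial x.1 + X.raw.φ .g .x3 trivial x.2)
      rw [map_add, map_add]
      exact congrArg₂ (· + ·)
        (((RHom.comm f .x2 .x3 trivial x.1).trans
        (congrArg (Y.raw.φ .x2 .x3 trivial) (h2 x.1))).trans (RHom.comm g .x2 .x3 trivial x.1).symm)
        (((RHom.comm f .g .x3 trivial x.2).trans
        (congrArg (Y.raw.φ .g .x3 trivial) (hg x.2))).trans (RHom.comm g .g .x3 trivial x.2).symm)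

lemma resS_ext (X Y : Raw k VX MX) (hX : PX X) (hY : PX Y) (p1 : X.V .x1 →ₗ[k] Y.V .x1)
    (p2 : X.V .x2 →ₗ[k] Y.V .x2) (pf : X.V .f →ₗ[k] Y.V .f) (pg : X.V .g →ₗ[k] Y.V .g)
    (h1f : ∀ x, pf (X.φ .x1 .f trivial x) = Y.φ .x1 .f trivial (p1 x))
    (hf2 : ∀ x, p2 (X.φ .f .x2 trivial x) = Y.φ .f .x2 trivial (pf x))
    (hfg : ∀ x, pg (X.φ .f .g trivial x) = Y.φ .f .g trivial (pf x)) :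
    ∃ G : RHom X Y, G.g .x1 = p1 ∧ G.g .x2 = p2 ∧ G.g .f = pf ∧ G.g .g = pg := by
  have h12 : ∀ x, p2 (X.φ .x1 .x2 trivial x) =
    Y.φ .x1 .x2 trivial (p1 x) := fun x => by
      rw [← hX.c1, ← hY.c1, hf2, h1f]
  obtain ⟨g4, hg4⟩ := desc_surj (X.φ .x2 .x4 trivial) hX.fsurj
    ((Y.φ .x2 .x4 trivial).comp p2) (fun x hx => by
      obtain ⟨z, rfl⟩ := (hX.fex x).1 hx
      exact (hY.fex _).2 ⟨pf z, (hf2 z).symm⟩)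
  obtain ⟨g3, hg3⟩ := desc_surj (sum3 X) (sum3_surj _ hX)
    ((sum3 Y).comp (LinearMap.prodMap p2 pg)) (fun x hx => by
      obtain ⟨u, hu, hu'⟩ := sum3_ker _ hX x hx
      change Y.φ .x2 .x3 trivial (p2 x.1) +
        Y.φ .g .x3 trivial (pg x.2) = 0
      rw [← hu, ← hu', map_neg, map_neg, hf2, hfg, hY.sq, add_neg_cancel])
  have h23 : ∀ x, g3 (X.φ .x2 .x3 trivial x) =
    Y.φ .x2 .x3 trivial (p2 x) := fun x => by
      have := hg3 (x, 0)
      change g3 (X.φ .x2 .x3 trivial x + X.φ .g .x3 trivial 0) =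
        Y.φ .x2 .x3 trivial (p2 x) +
        Y.φ .g .x3 trivial (pg 0) at this
      simpa only [map_zero, add_zero] using this
  have hg3' : ∀ x, g3 (X.φ .g .x3 trivial x) =
    Y.φ .g .x3 trivial (pg x) := fun x => by
      have := hg3 (0, x)
      change g3 (X.φ .x2 .x3 trivial 0 + X.φ .g .x3 trivial x) =
        Y.φ .x2 .x3 trivial (p2 0) +
        Y.φ .g .x3 trivial (pg x) at this
      simpa only [map_zero, zero_add] using this
  have h24 : ∀ x, g4 (X.φ .x2 .x4 trivial x) =
    Y.φ .x2 .x4 trivial (p2 x) := hg4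
  have h34 : ∀ x, g4 (X.φ .x3 .x4 trivial x) =
    Y.φ .x3 .x4 trivial (g3 x) := fun x => by
      obtain ⟨x, rfl⟩ := sum3_surj _ hX x
      change g4 (X.φ .x3 .x4 trivial (X.φ .x2 .x3 trivial x.1 +
        X.φ .g .x3 trivial x.2)) = Y.φ .x3 .x4 trivial (g3 (X.φ .x2 .x3 trivial x.1 +
        X.φ .g .x3 trivial x.2))
      rw [map_add, map_add, map_add, map_add, h23, hg3', hX.c2, hY.c2,
        (hX.gex _).2 ⟨_, rfl⟩, (hY.gex _).2 ⟨_, rfl⟩, map_zero, add_zero, add_zero, h24]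
  let G : ∀ u, X.V u →ₗ[k] Y.V u := fun u => match u with
    | .x1 => p1
    | .x2 => p2
    | .f => pf
    | .g => pg
    | .x3 => g3
    | .x4 => g4
  refine ⟨⟨G, ?_⟩, rfl, rfl, rfl, rfl⟩
  · intro v w m x
    cases v <;> cases w <;> first
      | exact (m : False).elim
      | exact h12 x
      | exact h23 x
      | exact h34 x
      | exact h24 x
      | exact h1f x
      | exact hfg x
      | exact hf2 x
      | exact hg3' x

instance : (resS k).Full where
  map_surjective {X Y} h := by
    obtain ⟨G, h1, h2, h3, h4⟩ := resS_ext X.raw Y.raw X.prop Y.prop (RHom.g h .l1) (RHom.g h .l2)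
      (RHom.g h .c) (RHom.g h .x) (RHom.comm h .l1 .c id) (RHom.comm h .c .l2 trivial)
      (RHom.comm h .c .x trivial)
    refine ⟨G, QRep.hom_ext fun v x => ?_⟩
    cases v with
    | l1 => exact LinearMap.congr_fun h1 x
    | l2 => exact LinearMap.congr_fun h2 x
    | c => exact LinearMap.congr_fun h3 x
    | x => exact LinearMap.congr_fun h4 x

end NakPart

section NakPart2

open CategoryTheory Limits

variable {k : Type} [Field k]

/-- Extension of a representation of the linear quiver by kernels. -/
def extN (Z : Raw k VN MN) (hZ : PN Z) : Raw k VX MX where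
  V u := match u with
    | .x1 => Z.V .y1
    | .x2 => Z.V .y2
    | .x3 => Z.V .y3
    | .x4 => Z.V .y4
    | .f => ModuleCat.of k (LinearMap.ker ((Z.φ .y3 .y4 trivial).comp (Z.φ .y2 .y3 trivial)))
    | .g => ModuleCat.of k (LinearMap.ker (Z.φ .y3 .y4 trivial))
  φ u u' m := match u, u', m with
    | .x1, .f, _ => (Z.φ .y1 .y2 trivial).codRestrict _ hZ
    | .x1, .x2, _ => Z.φ .y1 .y2 trivial
    | .f, .x2, _ => Submodule.subtype _
    | .f, .g, _ => ((Z.φ .y2 .y3 trivial).comp (Submodule.subtype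
        (LinearMap.ker ((Z.φ .y3 .y4 trivial).comp (Z.φ .y2 .y3 trivial))))).codRestrict _
        (fun x => x.2)
    | .x2, .x3, _ => Z.φ .y2 .y3 trivial
    | .x2, .x4, _ => (Z.φ .y3 .y4 trivial).comp (Z.φ .y2 .y3 trivial)
    | .g, .x3, _ => Submodule.subtype _
    | .x3, .x4, _ => Z.φ .y3 .y4 trivial
    | _, _, _ => 0

lemma extN_P (Z : Raw k VN MN) (hZ : PN Z)
    (hs : Function.Surjective ((Z.φ .y3 .y4 trivial).comp (Z.φ .y2 .y3 trivial))) :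
    PX (extN Z hZ) where
  c1 _ := rfl
  c2 _ := rfl
  sq _ := rfl
  ginj := Subtype.val_injective
  gsurj y := by
    obtain ⟨x, hx⟩ := hs y
    exact ⟨Z.φ .y2 .y3 trivial x, hx⟩
  gex y := ⟨fun h => ⟨⟨y, h⟩, rfl⟩, fun ⟨x, hx⟩ => hx ▸ x.2⟩
  finj := Subtype.val_injective
  fsurj := hs
  fex y := ⟨fun h => ⟨⟨y, h⟩, rfl⟩, fun ⟨x, hx⟩ => hx ▸ x.2⟩

lemma resN_ess (Z : QRep (PN (k := k)))
    (hs : Function.Surjective ((Z.raw.φ .y3 .y4 trivial).comp (Z.raw.φ .y2 .y3 trivial))) :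
    (resN k).essImage Z := by
  refine QRep.essImage_of _ ⟨extN Z.raw Z.prop, extN_P _ _ hs⟩ _
    (fun u => match u with
      | .y1 => LinearEquiv.refl k _
      | .y2 => LinearEquiv.refl k _
      | .y3 => LinearEquiv.refl k _
      | .y4 => LinearEquiv.refl k _) ?_
  intro v w m x
  cases v <;> cases w <;> first | rfl | exact (m : False).elim

/-- The antidiagonal map. -/
def anti (Z : Raw k VD (MD False True True)) : Z.V .c →ₗ[k] Z.V .l2 × Z.V .x :=
  (Z.φ .c .l2 trivial).prod (-(Z.φ .c .x trivial))

/-- Extension of a representation of the star by cokernels. -/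
def extS (Z : Raw k VD (MD False True True)) : Raw k VX MX where
  V u := match u with
    | .x1 => Z.V .l1
    | .x2 => Z.V .l2
    | .f => Z.V .c
    | .g => Z.V .x
    | .x3 => ModuleCat.of k ((Z.V .l2 × Z.V .x) ⧸ LinearMap.range (anti Z))
    | .x4 => ModuleCat.of k (Z.V .l2 ⧸ LinearMap.range (Z.φ .c .l2 trivial))
  φ u u' m := match u, u', m with
    | .x1, .f, _ => Z.φ .l1 .c id
    | .x1, .x2, _ => (Z.φ .c .l2 trivial).comp (Z.φ .l1 .c id)
    | .f, .x2, _ => Z.φ .c .l2 trivial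
    | .f, .g, _ => Z.φ .c .x trivial
    | .x2, .x3, _ => (Submodule.mkQ (LinearMap.range (anti Z))).comp (LinearMap.inl k _ _)
    | .x2, .x4, _ => Submodule.mkQ _
    | .g, .x3, _ => (Submodule.mkQ (LinearMap.range (anti Z))).comp (LinearMap.inr k _ _)
    | .x3, .x4, _ => (LinearMap.range (anti Z)).liftQ
        ((Submodule.mkQ (LinearMap.range (Z.φ .c .l2 trivial))).comp (LinearMap.fst k _ _))
        (by
          rintro _ ⟨x, rfl⟩
          exact (Submodule.Quotient.mk_eq_zero _).2 ⟨x, rfl⟩)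
    | _, _, _ => 0

lemma extS_P (Z : Raw k VD (MD False True True))
    (hs : Function.Injective (Z.φ .c .l2 trivial)) : PX (extS Z) where
  c1 _ := rfl
  c2 _ := rfl
  sq x := by
    refine (Submodule.Quotient.eq (LinearMap.range (anti Z))).2 ⟨x, Prod.ext ?_ ?_⟩
    · exact (sub_zero _).symm
    · exact (zero_sub _).symm
  ginj := by
    refine (injective_iff_map_eq_zero
      ((Submodule.mkQ (LinearMap.range (anti Z))).comp (LinearMap.inr k _ _))).2 fun x hx => ?_
    obtain ⟨c, hc⟩ := (Submodule.Quotient.mk_eq_zero (LinearMap.range (anti Z))).1 hx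
    have h0 : Z.φ .c .l2 trivial c = 0 := congrArg Prod.fst hc
    have h1 : - Z.φ .c .x trivial c = x := congrArg Prod.snd hc
    have h2 : c = 0 := hs (h0.trans (map_zero _).symm)
    rw [← h1, h2, map_zero, neg_zero]
  gsurj y := by
    obtain ⟨x, hx⟩ := Submodule.mkQ_surjective (LinearMap.range (Z.φ .c .l2 trivial)) y
    exact ⟨Submodule.mkQ (LinearMap.range (anti Z)) (x, 0), hx⟩
  gex y := by
    constructor
    · intro h
      obtain ⟨⟨a, b⟩, rfl⟩ := Submodule.mkQ_surjective (LinearMap.range (anti Z)) y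
      obtain ⟨c, hc⟩ := (Submodule.Quotient.mk_eq_zero (LinearMap.range (Z.φ .c .l2 trivial))).1 h
      have hc' : Z.φ .c .l2 trivial c = a := hc
      refine ⟨b + Z.φ .c .x trivial c,
        (Submodule.Quotient.eq (LinearMap.range (anti Z))).2 ⟨- c, Prod.ext ?_ ?_⟩⟩
      · change Z.φ .c .l2 trivial (-c) = 0 - a
        rw [map_neg, hc', zero_sub]
      · change - Z.φ .c .x trivial (-c) = b + Z.φ .c .x trivial c - b
        rw [map_neg, neg_neg, add_sub_cancel_left]
    · rintro ⟨x, rfl⟩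
      exact map_zero (Submodule.mkQ (LinearMap.range (Z.φ .c .l2 trivial)))
  finj := hs
  fsurj := Submodule.mkQ_surjective _
  fex y := Submodule.Quotient.mk_eq_zero (LinearMap.range (Z.φ .c .l2 trivial))

lemma resS_ess (Z : QRep (fun _ : Raw k VD (MD False True True) => True))
    (hs : Function.Injective (Z.raw.φ .c .l2 trivial)) : (resS k).essImage Z := by
  refine QRep.essImage_of _ ⟨extS Z.raw, extS_P _ hs⟩ _
    (fun u => match u with
      | .c => LinearEquiv.refl k _
      | .l1 => LinearEquiv.refl k _
      | .l2 => LinearEquiv.refl k _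
      | .x => LinearEquiv.refl k _) ?_
  intro v w m x
  cases v <;> cases w <;> first | rfl | exact (m : False).elim | exact (m trivial).elim

/-- The resolution datum for the linear quiver. -/
def dN (k : Type) [Field k] : RD k VN where
  S u := match u with
    | .y2 => True
    | .y3 => True
    | _ => False
  A u u' := match u, u' with
    | .y3, .y4 => 1
    | _, _ => 0
  B u u' := match u, u' with
    | .y2, .y3 => 1
    | _, _ => 0
  J := 0

/-- The resolution datum for the star. -/
def dS (k : Type) [Field k] : RD k VD where
  S u := u = .l2
  A := 0
  B := 0
  J u u' := match u, u' with
    | .c, .l2 => 1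
    | _, _ => 0

variable {Q₁ : PreQuiver} {R₁ : Set (List Q₁.A)} {Q₂ : PreQuiver} {R₂ : Set (List Q₂.A)}

lemma dN_12 (Y : CochainComplex (QRep (PN (k := k))) ℤ) (n : ℤ) (y c) :
    ((dN k).raw Y n).φ .y1 .y2 trivial (y, c) = ((Y.X n).raw.φ .y1 .y2 trivial y, 0) := by
  refine ((dN k).raw_φ Y n VN.y1 VN.y2 trivial y c).trans (Prod.ext ?_ ?_)
  · change _ + (0 : k) • _ = _
    rw [zero_smul, add_zero]
  · change (dN k).ee Y VN.y2 ((0 : k) • _ + (0 : k) • _) = 0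
    rw [zero_smul, zero_smul, add_zero, map_zero]

lemma dN_23 (Y : CochainComplex (QRep (PN (k := k))) ℤ) (n : ℤ) (y c) :
    ((dN k).raw Y n).φ .y2 .y3 trivial (y, c) = ((Y.X n).raw.φ .y2 .y3 trivial y,
      (dN k).ee Y .y3 ((dN k).rr Y .y2 c)) := by
  refine ((dN k).raw_φ Y n VN.y2 VN.y3 trivial y c).trans (Prod.ext ?_ ?_)
  · change _ + (0 : k) • _ = _
    rw [zero_smul, add_zero]
  · change (dN k).ee Y VN.y3 ((1 : k) • _ + (0 : k) • _) = _
    rw [zero_smul, one_smul, add_zero]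

lemma dN_34 (Y : CochainComplex (QRep (PN (k := k))) ℤ) (n : ℤ) (y c) :
    ((dN k).raw Y n).φ .y3 .y4 trivial (y, c) = ((Y.X n).raw.φ .y3 .y4 trivial y +
      RD.pr Y n VN.y4 ((dN k).rr Y .y3 c), 0) := by
  refine ((dN k).raw_φ Y n VN.y3 VN.y4 trivial y c).trans (Prod.ext ?_ ?_)
  · change _ + (1 : k) • _ = _
    rw [one_smul]
  · exact funext fun p => p.down.elim

/-- The side of the linear quiver. -/
def sideN (D : TD k Q₁ R₁ VN MN PN) : Side k Q₁ R₁ (QRep (PX (k := k))) VN MN PN where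
  D := D
  δ := dN k
  hP Y n := by
    rintro ⟨y, c⟩
    refine (congrArg (fun t => ((dN k).raw Y n).φ .y3 .y4 trivial
      (((dN k).raw Y n).φ .y2 .y3 trivial t)) (dN_12 Y n y c)).trans ?_
    refine (congrArg (fun t => ((dN k).raw Y n).φ .y3 .y4 trivial t) (dN_23 Y n _ _)).trans ?_
    refine (dN_34 Y n _ _).trans (Prod.ext ?_ rfl)
    refine (congrArg₂ (· + ·) ((Y.X n).prop y) ?_).trans (add_zero _)
    rw [map_zero, map_zero, map_zero, map_zero]
  r := resN k
  add := inferInstance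
  full := inferInstance
  faithful := inferInstance
  ess Y n := by
    apply resN_ess
    rintro ⟨y, c⟩
    obtain ⟨c', hc⟩ := RD.pr_surj Y n VN.y4 y
    refine ⟨(0, (dN k).ee Y VN.y2 c'), ?_⟩
    refine (congrArg (fun t => ((dN k).raw Y n).φ .y3 .y4 trivial t) (dN_23 Y n _ _)).trans ?_
    refine (dN_34 Y n _ _).trans (Prod.ext ?_ (funext fun p => p.down.elim))
    change (Y.X n).raw.φ .y3 .y4 trivial ((Y.X n).raw.φ .y2 .y3 trivial 0) +
      RD.pr Y n VN.y4 ((dN k).rr Y .y3 ((dN k).ee Y .y3 ((dN k).rr Y .y2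
      ((dN k).ee Y VN.y2 c')))) = y
    rw [RD.rr_ee _ _ _ trivial, RD.rr_ee _ _ _ trivial, hc, map_zero, map_zero, zero_add]
  JA := Or.inl rfl

/-- The side of the star. -/
def sideS (D : TD k Q₂ R₂ VD (MD False True True) (fun _ => True)) :
    Side k Q₂ R₂ (QRep (PX (k := k))) VD (MD False True True) (fun _ => True) where
  D := D
  δ := dS k
  hP _ _ := trivial
  r := resS k
  add := inferInstance
  full := inferInstance
  faithful := inferInstance
  ess Y n := by
    apply resS_ess
    rw [injective_iff_map_eq_zero]
    rintro ⟨y, c⟩ h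
    have h1 := ((dS k).raw_φ Y n VD.c VD.l2 trivial y c).symm.trans h
    have h2 := congrFun (congrArg Prod.snd h1) ⟨rfl⟩
    change (0 : k) • (dS k).rr Y VD.c c + (1 : k) • RD.jn Y n VD.c y = 0 at h2
    rw [zero_smul, zero_add, one_smul] at h2
    refine Prod.ext (RD.jn_inj Y n VD.c y h2) (funext fun p => ?_)
    exact VD.noConfusion p.down
  JA := Or.inr rfl

lemma nak_W {K L : CochainComplex (QRep (PX (k := k))) ℤ} (f : K ⟶ L) :
    (∀ v, QuasiIso (((resN k ⋙ QRep.ev _ v).mapHomologicalComplex _).map f)) ↔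
    (∀ v, QuasiIso (((resS k ⋙ QRep.ev _ v).mapHomologicalComplex _).map f)) := by
  have hf := QRep.ses (P := PX (k := k)) VX.f VX.x2 VX.x4 trivial trivial
    (fun X h => h.finj) (fun X h => h.fsurj) (fun X h => h.fex) f
  have hg := QRep.ses (P := PX (k := k)) VX.g VX.x3 VX.x4 trivial trivial
    (fun X h => h.ginj) (fun X h => h.gsurj) (fun X h => h.gex) f
  constructor
  · intro h u
    cases u with
    | c => exact hf.2.2 (h .y2) (h .y4)
    | l1 => exact h .y1
    | l2 => exact h .y2
    | x => exact hg.2.2 (h .y3) (h .y4)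
  · intro h u
    have h4 := hf.1 (h .c) (h .l2)
    cases u with
    | y1 => exact h .l1
    | y2 => exact h .l2
    | y3 => exact hg.2.1 (h .x) h4
    | y4 => exact h4

theorem nak_star (D₁ : TD k Q₁ R₁ VN MN PN)
    (D₂ : TD k Q₂ R₂ VD (MD False True True) (fun _ => True)) :
    DerivedEquivalent k (PathAlgebraRel k Q₁ R₁) (PathAlgebraRel k Q₂ R₂) :=
  Side.equiv (sideN D₁) (sideS D₂) (fun f => nak_W f)

end NakPart2

section FinalPart

open CategoryTheory Limits

variable {k : Type} [Field k]

/-- The numbering of the vertices of the star. -/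
def numS : Fin 4 ≃ VD where
  toFun i := match i with
    | 0 => .c
    | 1 => .l1
    | 2 => .l2
    | 3 => .x
  invFun v := match v with
    | .c => 0
    | .l1 => 1
    | .l2 => 2
    | .x => 3
  left_inv i := by fin_cases i <;> rfl
  right_inv v := by cases v <;> rfl

/-- The numbering of the vertices of the linear quiver. -/
def numN : Fin 4 ≃ VN where
  toFun i := match i with
    | 0 => .y1
    | 1 => .y2
    | 2 => .y3
    | 3 => .y4
  invFun v := match v with
    | .y1 => 0
    | .y2 => 1
    | .y3 => 2
    | .y4 => 3
  left_inv i := by fin_cases i <;> rfl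
  right_inv v := by cases v <;> rfl

/-- Exchange of the first and the third leaf. -/
def swap1 : VD ≃ VD where
  toFun v := match v with
    | .c => .c
    | .l1 => .x
    | .l2 => .l2
    | .x => .l1
  invFun v := match v with
    | .c => .c
    | .l1 => .x
    | .l2 => .l2
    | .x => .l1
  left_inv v := by cases v <;> rfl
  right_inv v := by cases v <;> rfl

/-- Exchange of the second and the third leaf. -/
def swap2 : VD ≃ VD where
  toFun v := match v with
    | .c => .c
    | .l1 => .l1
    | .l2 => .x
    | .x => .l2
  invFun v := match v with
    | .c => .c
    | .l1 => .l1
    | .l2 => .x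
    | .x => .l2
  left_inv v := by cases v <;> rfl
  right_inv v := by cases v <;> rfl

/-- The orientation with given directions. -/
def orS (e1 e2 e3 : Prop) (v w : Fin 4) : Prop := MD e1 e2 e3 (numS v) (numS w)

/-- The comparison data for a star. -/
def tdS (k : Type) [Field k] (o : Fin 4 → Fin 4 → Prop) (σ : Fin 4 ≃ VD) (M : VD → VD → Prop)
    (h : ∀ v w, o v w ↔ M (σ v) (σ w)) :
    TD k (orientQuiver (Fin 4) o) ∅ VD M (fun _ => True) where
  σ := σ
  hM a := (h _ _).1 a.2
  surj v w m := ⟨⟨(σ.symm v, σ.symm w), (h _ _).2 (by simpa using m)⟩,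
    σ.apply_symm_apply v, σ.apply_symm_apply w⟩
  inj a b h1 h2 := Subtype.ext (Prod.ext h1 h2)
  hP X := ⟨fun _ p hp => (Set.notMem_empty p hp).elim, fun _ => trivial⟩

/-- The comparison data, with the third leaf last. -/
def td3 (k : Type) [Field k] (e1 e2 e3 : Prop) :
    TD k (orientQuiver (Fin 4) (orS e1 e2 e3)) ∅ VD (MD e1 e2 e3) (fun _ => True) :=
  tdS k _ numS _ (fun _ _ => Iff.rfl)

/-- The comparison data, with the second leaf last. -/
def td2 (k : Type) [Field k] (e1 e2 e3 : Prop) :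
    TD k (orientQuiver (Fin 4) (orS e1 e2 e3)) ∅ VD (MD e1 e3 e2) (fun _ => True) :=
  tdS k _ (numS.trans swap2) _ (fun v w => by
    fin_cases v <;> fin_cases w <;> exact Iff.rfl)

/-- The comparison data, with the first leaf last. -/
def td1 (k : Type) [Field k] (e1 e2 e3 : Prop) :
    TD k (orientQuiver (Fin 4) (orS e1 e2 e3)) ∅ VD (MD e3 e2 e1) (fun _ => True) :=
  tdS k _ (numS.trans swap1) _ (fun v w => by
    fin_cases v <;> fin_cases w <;> exact Iff.rfl)

lemma linPath_eq : linPath 4 1 3 = [(0 : Fin 3), (1 : Fin 3), (2 : Fin 3)] := by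
  rfl

lemma numN_M (a : Fin 3) : MN (numN ((linQuiver 4).s a)) (numN ((linQuiver 4).t a)) := by
  fin_cases a <;> exact trivial

/-- The comparison data for the linear quiver. -/
def tdN (k : Type) [Field k] :
    TD k (linQuiver 4) {p | ∃ i : Fin 1, p = linPath 4 ((fun _ => 1) i) ((fun _ => 3) i)}
      VN MN PN where
  σ := numN
  hM := numN_M
  surj v w m := by
    cases v <;> cases w <;> first
      | exact (m : False).elim
      | exact ⟨(0 : Fin 3), rfl, rfl⟩
      | exact ⟨(1 : Fin 3), rfl, rfl⟩
      | exact ⟨(2 : Fin 3), rfl, rfl⟩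
  inj a b h _ := Fin.ext (Fin.mk.inj h)
  hP X := by
    have key : ((linPath 4 1 3).map fun a => MulOpposite.op (arEnd X _ _ (numN_M a))).prod =
        MulOpposite.op ((arEnd X .y3 .y4 trivial) * ((arEnd X .y2 .y3 trivial) *
          (arEnd X .y1 .y2 trivial))) := by
      rw [linPath_eq]
      change MulOpposite.op (arEnd X .y1 .y2 trivial) * (MulOpposite.op (arEnd X .y2 .y3 trivial) *
        (MulOpposite.op (arEnd X .y3 .y4 trivial) * 1)) = _
      rw [mul_one, ← MulOpposite.op_mul, ← MulOpposite.op_mul, mul_assoc]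
    constructor
    · rintro h p ⟨i, rfl⟩
      refine key.trans ?_
      rw [MulOpposite.op_eq_zero_iff]
      refine LinearMap.ext fun x => funext fun u => ?_
      change arEnd X .y3 .y4 trivial (arEnd X .y2 .y3 trivial (arEnd X .y1 .y2 trivial x)) u = 0
      by_cases hu : u = .y4
      · subst hu
        rw [TD.arEnd_same, TD.arEnd_same, TD.arEnd_same]
        exact h _
      · exact TD.arEnd_ne _ _ _ _ _ hu _
    · intro h x
      classical
      have h1 := key.symm.trans (h _ ⟨0, rfl⟩)
      rw [MulOpposite.op_eq_zero_iff] at h1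
      have h2 : arEnd X .y3 .y4 trivial (arEnd X .y2 .y3 trivial (arEnd X .y1 .y2 trivial
        (LinearMap.single k (fun w => X.V w) .y1 x))) .y4 = 0 :=
          congrFun (LinearMap.congr_fun h1 (LinearMap.single k (fun w => X.V w) .y1 x)) .y4
      rw [TD.arEnd_same, TD.arEnd_same, TD.arEnd_same] at h2
      simpa using h2

lemma orient_eq (o : Fin 4 → Fin 4 → Prop) (ho : IsOrientation dynkinD4 o) :
    o = orS (o 0 1) (o 0 2) (o 0 3) := by
  obtain ⟨h1, h2⟩ := ho
  have ha : ∀ v w : Fin 4, dynkinD4.Adj v w ↔ v ≠ w ∧ (v = 0 ∨ w = 0) := by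
    intro v w
    have e : ∀ u : Fin 4, u.1 = 0 ↔ u = 0 := fun u => by
      rw [Fin.ext_iff]; exact Iff.rfl
    exact (SimpleGraph.fromRel_adj _ v w).trans (and_congr_right fun _ => or_congr (e v) (e w))
  have hn : ∀ v w : Fin 4, ¬ (v ≠ w ∧ (v = 0 ∨ w = 0)) → ¬ o v w := fun v w h h' =>
    h ((ha v w).1 ((h1 v w).2 (Or.inl h')))
  have hr : ∀ w : Fin 4, w ≠ 0 → (o w 0 ↔ ¬ o 0 w) := fun w hw =>
    ⟨h2 w 0, fun h => ((h1 w 0).1 ((ha w 0).2 ⟨hw, Or.inr rfl⟩)).resolve_right h⟩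
  funext v w
  apply propext
  fin_cases v <;> fin_cases w <;> first
    | exact Iff.rfl
    | exact hr _ (by decide)
    | exact iff_of_false (hn _ _ (by decide)) id

theorem nak_orS (k : Type) [Field k] (e1 e2 e3 : Prop) :
    DerivedEquivalent k (NakayamaAlgebra k 4 1 (fun _ => 1) (fun _ => 3))
      (PathAlgebra k (orientQuiver (Fin 4) (orS e1 e2 e3))) := by
  have s0 := nak_star (tdN k) (td3 k False True True)
  have s3 : DerivedEquivalent k (NakayamaAlgebra k 4 1 (fun _ => 1) (fun _ => 3))
      (PathAlgebra k (orientQuiver (Fin 4) (orS False True e3))) := by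
    by_cases h : e3
    · rw [eq_true h]; exact s0
    · rw [eq_false h]
      exact s0.trans (flip_LR (td3 k False True True) (td3 k False True False))
  have s2 : DerivedEquivalent k (NakayamaAlgebra k 4 1 (fun _ => 1) (fun _ => 3))
      (PathAlgebra k (orientQuiver (Fin 4) (orS False e2 e3))) := by
    by_cases h : e2
    · rw [eq_true h]; exact s3
    · rw [eq_false h]
      exact s3.trans (flip_LR (td2 k False True e3) (td2 k False False e3))
  by_cases h : e1
  · rw [eq_true h]
    exact s2.trans (flip_RL (td1 k True e2 e3) (td1 k False e2 e3))
  · rw [eq_false h]; exact s2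

end FinalPart

/-- The linear Nakayama algebra `A_{4,(1)}^{(3)}` is derived equivalent to
the path algebra of any orientation of the Dynkin tree `D_4`. -/
theorem nakayama_D4 (k : Type) [Field k] (o : Fin 4 → Fin 4 → Prop)
    (ho : IsOrientation dynkinD4 o) :
    DerivedEquivalent k (NakayamaAlgebra k 4 1 (fun _ => 1) (fun _ => 3))
      (PathAlgebra k (orientQuiver (Fin 4) o)) := by
  rw [orient_eq o ho]
  exact nak_orS k _ _ _
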